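/- (Nondefectivity and generic rank for Segre–Veronese varieties.) Let t ≥ 1 and n, d : Fin t → ℕ with n i ≥ 1 and d i ≥ 1 for all i. Let 𝓛 be the space of multihomogeneous polynomials of multidegree d, let SV ⊆ 𝓛 be the Zariski closure of the set of products ∏ i, (ℓ i)^(d i), where each ℓ i is a homogeneous linear form in the i-th group of variables, and set N := (∑ i, n i) − t + 1 and D := ∏ i, choose (n i + d i − 1) (d i). Then dim SV = N; for every m ≥ 1 with N * (m + N) ≤ D, the m-th secant variety σ_m SV has dimension exactly m * N; and for every m ≥ 1 with m * N ≥ D + N^2, σ_m SV equals all of 𝓛. -/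

import Mathlib

noncomputable section

open MvPolynomial

/-- The Zariski topology on a `ℂ`-vector space `M` (for finite-dimensional `M`,
identified with a coordinate space via a basis, this is the topology in which a set
is closed iff it is the common zero locus of a family of polynomial functions
of the coordinates). -/
def ztV (M : Type*) [AddCommGroup M] [Module ℂ M] : TopologicalSpace M :=
  TopologicalSpace.generateFrom
    { U | ∃ (k : ℕ) (p : MvPolynomial (Fin k) ℂ) (L : Fin k → M →ₗ[ℂ] ℂ),
        U = { x | MvPolynomial.eval (fun i => L i x) p ≠ 0 } }

def zIsOpenV {M : Type*} [AddCommGroup M] [Module ℂ M] (S : Set M) : Prop :=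
  @IsOpen _ (ztV M) S

def zClosureV {M : Type*} [AddCommGroup M] [Module ℂ M] (S : Set M) : Set M :=
  @closure _ (ztV M) S

/-- The topological Krull dimension of `S` (with the subspace Zariski topology):
the supremum of lengths of chains of irreducible closed subsets. -/
def zDimV {M : Type*} [AddCommGroup M] [Module ℂ M] (S : Set M) : WithBot ℕ∞ :=
  @topologicalKrullDim ↥S (TopologicalSpace.induced Subtype.val (ztV M))

/-- The `m`-th secant variety: the Zariski closure of the set of sums of `m` points of `V`. -/
def secantV {M : Type*} [AddCommGroup M] [Module ℂ M] (m : ℕ) (V : Set M) : Set M :=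
  zClosureV { p | ∃ x : Fin m → M, (∀ i, x i ∈ V) ∧ p = ∑ i, x i }

/-- `V` is `m`-identifiable: there is a dense open subset `O` of `σ_m V` such that every
`p ∈ O` is a sum of `m` points of `V`, uniquely up to a permutation of the summands. -/
def IsIdentifiableV {M : Type*} [AddCommGroup M] [Module ℂ M] (m : ℕ) (V : Set M) : Prop :=
  ∃ O : Set M, O ⊆ secantV m V ∧
    (∃ U, zIsOpenV U ∧ O = U ∩ secantV m V) ∧
    secantV m V ⊆ zClosureV O ∧
    ∀ p ∈ O,
      (∃ x : Fin m → M, (∀ i, x i ∈ V) ∧ p = ∑ i, x i) ∧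
      ∀ x y : Fin m → M, (∀ i, x i ∈ V) → (∀ i, y i ∈ V) →
        p = ∑ i, x i → p = ∑ i, y i →
          ∃ e : Equiv.Perm (Fin m), ∀ i, y i = x (e i)

/-- The space of multihomogeneous polynomials of multidegree `d`: every monomial has
total degree `d i` in the `i`-th group of variables. -/
def multiHomogeneousSubmodule (t : ℕ) (n d : Fin t → ℕ) :
    Submodule ℂ (MvPolynomial ((i : Fin t) × Fin (n i)) ℂ) where
  carrier := { f | ∀ μ : ((i : Fin t) × Fin (n i)) →₀ ℕ, MvPolynomial.coeff μ f ≠ 0 →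
    ∀ i : Fin t, ∑ j : Fin (n i), μ ⟨i, j⟩ = d i }
  add_mem' := by
    intro a b ha hb μ hμ i
    rw [MvPolynomial.coeff_add] at hμ
    by_cases h : MvPolynomial.coeff μ a = 0
    · exact hb μ (by simpa [h] using hμ) i
    · exact ha μ h i
  zero_mem' := by
    intro μ hμ
    simp at hμ
  smul_mem' := by
    intro c f hf μ hμ i
    rw [MvPolynomial.coeff_smul] at hμ
    exact hf μ (right_ne_zero_of_mul hμ) i

/-- The Segre–Veronese variety of multidegree `d`: the Zariski closure in the space of
multihomogeneous polynomials of the set of products `∏ i, (ℓ i) ^ (d i)` of powers of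
homogeneous linear forms `ℓ i` in the respective groups of variables. -/
def SegreVeronese (t : ℕ) (n d : Fin t → ℕ) : Set ↥(multiHomogeneousSubmodule t n d) :=
  zClosureV { f | ∃ ℓ : (i : Fin t) → Fin (n i) → ℂ,
    (f : MvPolynomial ((i : Fin t) × Fin (n i)) ℂ) =
      ∏ i, (∑ j, ℓ i j • MvPolynomial.X (⟨i, j⟩ : (i : Fin t) × Fin (n i))) ^ (d i) }

theorem ringKrullDim_eq_of_isIntegral_of_injective {R S : Type*} [CommRing R] [CommRing S]
    [IsDomain S] [Algebra R S] [Algebra.IsIntegral R S]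
    (hinj : Function.Injective (algebraMap R S)) :
    ringKrullDim S = ringKrullDim R := by
  apply le_antisymm
  · refine Order.krullDim_le_of_strictMono (PrimeSpectrum.comap (algebraMap R S)) ?_
    intro I J hIJ
    exact Ideal.IsIntegral.comap_lt_comap (R := R) hIJ
  · refine iSup_le fun l => ?_
    obtain ⟨Q, hQ, hQl⟩ := Ideal.exists_ideal_over_prime_of_isIntegral_of_isDomain (S := S)
      (RelSeries.head l).asIdeal (by
        rw [(RingHom.injective_iff_ker_eq_bot _).mp hinj]; exact bot_le)
    have : Q.LiesOver (RelSeries.head l).asIdeal := ⟨hQl.symm⟩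
    obtain ⟨L, hL, -⟩ := Ideal.exists_ltSeries_of_hasGoingUp l Q
    rw [← hL]
    exact Order.LTSeries.length_le_krullDim L

/-- The Krull dimension of a finitely generated domain over a field is its transcendence degree. -/
theorem ringKrullDim_eq_trdeg {k A : Type*} [Field k] [CommRing A] [IsDomain A] [Algebra k A]
    [Algebra.FiniteType k A] {s : ℕ} (hs : Algebra.trdeg k A = s) : ringKrullDim A = s := by
  obtain ⟨s', g, hg, hgi⟩ := exists_integral_inj_algHom_of_fg k A
  have hdim : ringKrullDim A = s' := by
    algebraize [g.toRingHom]
    have := Algebra.IsIntegral.mk hgi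
    rw [ringKrullDim_eq_of_isIntegral_of_injective (R := MvPolynomial (Fin s') k) hg,
      MvPolynomial.ringKrullDim_of_isNoetherianRing]
    simp
  have hind : AlgebraicIndependent k (fun i => g (X i)) := by
    have h : aeval (fun i => g (X i)) = g := by ext; simp
    rw [algebraicIndependent_iff_injective_aeval, h]
    exact hg
  have hbasis : IsTranscendenceBasis k (fun i => g (X i)) := by
    rw [hind.isTranscendenceBasis_iff_isAlgebraic]
    refine ⟨fun a => ?_⟩
    obtain ⟨p, hp, hpa⟩ := hgi a
    have hmem : ∀ c, g c ∈ Algebra.adjoin k (Set.range fun i => g (X i)) := by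
      intro c
      have h : g c = aeval (fun i => g (X i)) c := by
        congr 1; ext; simp
      rw [h, Algebra.adjoin_range_eq_range_aeval]
      exact ⟨c, rfl⟩
    let g' : MvPolynomial (Fin s') k →+* Algebra.adjoin k (Set.range fun i => g (X i)) :=
      (g : MvPolynomial (Fin s') k →+* A).codRestrict _ hmem
    refine IsIntegral.isAlgebraic ⟨p.map g', hp.map _, ?_⟩
    rw [Polynomial.eval₂_map]
    exact hpa
  have := hbasis.lift_cardinalMk_eq_trdeg
  rw [hs] at this
  simp at this
  rw [hdim, this]

/-- Jacobian criterion: polynomials over a field of characteristic zero whose gradients at some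
point are linearly independent are algebraically independent. -/
theorem algebraicIndependent_of_gradient {τ κ : Type*} [Fintype τ] [Fintype κ] [DecidableEq κ]
    {k : Type*} [Field k] [CharZero k] (f : κ → MvPolynomial τ k) (x : τ → k)
    (h : LinearIndependent k (fun a s => eval x (pderiv s (f a)))) :
    AlgebraicIndependent k f := by
  classical
  obtain ⟨B, hB⟩ : ∃ B : Matrix τ κ k,
      (Matrix.of fun a s => eval x (pderiv s (f a)) : Matrix κ τ k) * B = 1 := by
    rw [← Matrix.mulVec_surjective_iff_exists_right_inverse]
    have := (LinearIndependent.rank_matrix (M := Matrix.of fun a s => eval x (pderiv s (f a))) h)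
    rw [Matrix.rank] at this
    have h3 : LinearMap.range (Matrix.mulVecLin (Matrix.of fun a s => eval x (pderiv s (f a)))) = ⊤ := by
      apply Submodule.eq_top_of_finrank_eq
      rw [this]; simp
    exact LinearMap.range_eq_top.mp h3
  let G : Matrix κ τ (MvPolynomial τ k) := Matrix.of fun a s => pderiv s (f a)
  let B' : Matrix τ κ (MvPolynomial τ k) := B.map C
  let J : Matrix κ κ (MvPolynomial τ k) := G * B'
  have hJ : J.det ≠ 0 := by
    intro h0
    have h1 : eval x J.det = 1 := by
      rw [RingHom.map_det]
      have : (eval x).mapMatrix J = 1 := by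
        rw [← hB]
        ext a b
        simp [J, G, B', Matrix.mul_apply]
      rw [this, Matrix.det_one]
    rw [h0] at h1; simp at h1
  have key : ∀ v : κ → MvPolynomial τ k, (∀ s, ∑ a, v a * pderiv s (f a) = 0) → v = 0 := by
    intro v hv
    apply Matrix.eq_zero_of_vecMul_eq_zero hJ
    simp only [J]
    rw [← Matrix.vecMul_vecMul]
    have : Matrix.vecMul v G = 0 := by
      ext1 s
      exact hv s
    rw [this, Matrix.zero_vecMul]
  have chain : ∀ (P : MvPolynomial κ k) s,
      pderiv s (aeval f P) = ∑ a, aeval f (pderiv a P) * pderiv s (f a) := by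
    intro P s
    induction P using MvPolynomial.induction_on with
    | C c => simp
    | add p q hp hq => simp only [map_add, hp, hq, add_mul, Finset.sum_add_distrib]
    | mul_X p b hp =>
      simp only [map_mul, aeval_X, Derivation.leibniz, smul_eq_mul, hp, map_add]
      simp only [pderiv_X, Pi.single_apply, add_mul, Finset.sum_add_distrib, Finset.mul_sum]
      congr 1
      · rw [Finset.sum_eq_single b] <;> simp +contextual [eq_comm]
      · apply Finset.sum_congr rfl; intros; ring
  rw [algebraicIndependent_iff]
  intro P
  induction hn : P.totalDegree using Nat.strong_induction_on generalizing P with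
  | _ m ih =>
  intro hP
  have hd : ∀ a, aeval f (pderiv a P) = 0 := by
    have := key (fun a => aeval f (pderiv a P)) (fun s => by rw [← chain, hP, map_zero])
    exact fun a => congrFun this a
  have hzero : ∀ a, pderiv a P = 0 := by
    intro a
    by_cases hm : m = 0
    · subst hm
      rw [totalDegree_eq_zero_iff_eq_C] at hn
      rw [hn, pderiv_C]
    · by_contra hne
      refine hne (ih (pderiv a P).totalDegree ?_ _ rfl (hd a))
      obtain ⟨μ, hμ, hμd⟩ : ∃ μ ∈ (pderiv a P).support, (pderiv a P).totalDegree = μ.degree := by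
        obtain ⟨μ, hμ, h2⟩ := Finset.exists_mem_eq_sup (pderiv a P).support
          (by simpa using hne) (fun s => s.sum fun _ e => e)
        exact ⟨μ, hμ, h2⟩
      rw [hμd, ← hn]
      rw [mem_support_iff, coeff_pderiv] at hμ
      have := le_totalDegree (p := P) (s := μ + Finsupp.single a 1)
        (mem_support_iff.mpr (left_ne_zero_of_mul hμ))
      have h2 : (μ + Finsupp.single a 1).degree ≤ P.totalDegree := this
      rw [map_add, Finsupp.degree_single] at h2
      omega
  have hC : P = C (coeff 0 P) := by
    ext μ
    rw [coeff_C]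
    split_ifs with h0
    · rw [h0]
    · obtain ⟨a, ha⟩ : ∃ a, μ a ≠ 0 := by
        by_contra! hcon
        exact h0 (by ext a; simp [hcon a])
      have := congrArg (coeff (μ - Finsupp.single a 1)) (hzero a)
      rw [coeff_pderiv, tsub_add_cancel_of_le (by simpa using Nat.one_le_iff_ne_zero.mpr ha)] at this
      simp only [coeff_zero, mul_eq_zero] at this
      rcases this with h | h
      · exact h
      · exfalso; norm_cast at h
  rw [hC] at hP ⊢
  simp at hP
  simp [hP]

theorem topologicalKrullDim_eq_of_isInducing_of_closedPoints {X Y : Type*} [TopologicalSpace X]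
    [TopologicalSpace Y] [JacobsonSpace X] {f : Y → X} (hf : Topology.IsInducing f)
    (hr : closedPoints X ⊆ Set.range f) : topologicalKrullDim Y = topologicalKrullDim X := by
  apply le_antisymm hf.topologicalKrullDim_le
  have key : ∀ Z : Set X, IsLocallyClosed Z → Z.Nonempty → ∃ y, f y ∈ Z := by
    intro Z hZ hne
    obtain ⟨x, hxZ, hx⟩ := nonempty_inter_closedPoints hne hZ
    obtain ⟨y, rfl⟩ := hr hx
    exact ⟨y, hxZ⟩
  let g : TopologicalSpace.IrreducibleCloseds X → TopologicalSpace.IrreducibleCloseds Y :=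
    fun Z => ⟨f ⁻¹' Z, ⟨key Z Z.isClosed.isLocallyClosed Z.isIrreducible.nonempty, by
      rintro U V hU hV ⟨u, huZ, huU⟩ ⟨v, hvZ, hvV⟩
      obtain ⟨U', hU', rfl⟩ := hf.isOpen_iff.mp hU
      obtain ⟨V', hV', rfl⟩ := hf.isOpen_iff.mp hV
      exact key (Z ∩ (U' ∩ V'))
        (Z.isClosed.isLocallyClosed.inter (hU'.inter hV').isLocallyClosed)
        (Z.isIrreducible.isPreirreducible U' V' hU' hV' ⟨_, huZ, huU⟩ ⟨_, hvZ, hvV⟩)⟩,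
      Z.isClosed.preimage hf.continuous⟩
  refine Order.krullDim_le_of_strictMono g ?_
  intro Z Z' h
  refine lt_of_le_not_ge (fun y hy => h.le hy) fun hle => ?_
  obtain ⟨x, hx, hx'⟩ := Set.not_subset.mp h.not_ge
  obtain ⟨y, hy, hy'⟩ := key (Z' ∩ (Z : Set X)ᶜ)
    (Z'.isClosed.isLocallyClosed.inter Z.isClosed.isOpen_compl.isLocallyClosed) ⟨x, hx, hx'⟩
  exact hy' (hle hy)

section Zariski

variable {M : Type*} [AddCommGroup M] [Module ℂ M] {B : Type*} [Fintype B] (b : Module.Basis B ℂ M)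

theorem isInducing_pointToPoint :
    @Topology.IsInducing M (PrimeSpectrum (MvPolynomial B ℂ)) (ztV M) _
      (fun x => pointToPoint (k := ℂ) (b.equivFun x)) := by
  let _ := ztV M
  constructor
  rw [PrimeSpectrum.isTopologicalBasis_basic_opens.eq_generateFrom, induced_generateFrom_eq, ztV]
  congr 1
  ext U
  simp only [Set.mem_ofPred_eq, Set.mem_image, Set.mem_range]
  have hmem : ∀ (p : MvPolynomial B ℂ) (x : M), p ∉ (pointToPoint (k := ℂ) (b.equivFun x)).asIdeal ↔
      eval (b.equivFun x) p ≠ 0 := by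
    intro p x
    simp [pointToPoint, mem_vanishingIdeal_iff, aeval_eq_eval]
  constructor
  · rintro ⟨k, p, L, rfl⟩
    refine ⟨_, ⟨aeval (fun i => ∑ β, C (L i (b β)) * X β) p, rfl⟩, ?_⟩
    ext x
    rw [Set.mem_preimage, SetLike.mem_coe, PrimeSpectrum.mem_basicOpen, hmem]
    have : eval (b.equivFun x) (aeval (fun i => ∑ β, C (L i (b β)) * X β) p) =
        eval (fun i => L i x) p := by
      change eval (b.equivFun x) (bind₁ _ p) = _
      rw [← coe_aeval_eq_eval, RingHom.coe_coe, aeval_bind₁, ← coe_aeval_eq_eval, RingHom.coe_coe]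
      congr 2
      ext i
      conv_rhs => rw [← b.sum_repr x, map_sum]
      simp only [map_sum, map_mul, aeval_X, map_smul, smul_eq_mul, algHom_C, mul_comm]
      rfl
    rw [this]; rfl
  · rintro ⟨_, ⟨p, rfl⟩, rfl⟩
    obtain ⟨m, ⟨e⟩⟩ := Finite.exists_equiv_fin B
    refine ⟨m, rename e p, fun i => b.coord (e.symm i), ?_⟩
    ext x
    rw [Set.mem_preimage, SetLike.mem_coe, PrimeSpectrum.mem_basicOpen, hmem]
    simp only [Set.mem_ofPred_eq, eval_rename]
    have : (fun i => b.coord (e.symm i) x) ∘ e = b.equivFun x := by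
      ext β; simp
    rw [this]

theorem mem_zClosureV_iff (S : Set M) (x : M) : x ∈ zClosureV S ↔
    ∀ p : MvPolynomial B ℂ, (∀ y ∈ S, eval (b.equivFun y) p = 0) → eval (b.equivFun x) p = 0 := by
  let _ := ztV M
  change x ∈ closure S ↔ _
  rw [(isInducing_pointToPoint b).closure_eq_preimage_closure_image, Set.mem_preimage,
    ← PrimeSpectrum.zeroLocus_vanishingIdeal_eq_closure, PrimeSpectrum.mem_zeroLocus]
  simp only [SetLike.coe_subset_coe, SetLike.le_def, PrimeSpectrum.mem_vanishingIdeal]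
  simp [pointToPoint, mem_vanishingIdeal_iff, aeval_eq_eval]

theorem zDimV_eq_ringKrullDim_quotient (I : Ideal (MvPolynomial B ℂ)) (V : Set M)
    (hV : ∀ x, x ∈ V ↔ ∀ p ∈ I, eval (b.equivFun x) p = 0) :
    zDimV V = ringKrullDim (MvPolynomial B ℂ ⧸ I) := by
  let _ := ztV M
  rw [← PrimeSpectrum.topologicalKrullDim_eq_ringKrullDim]
  let ev : ∀ x : V, MvPolynomial B ℂ ⧸ I →+* ℂ := fun x =>
    Ideal.Quotient.lift I (eval (b.equivFun x)) ((hV x).mp x.2)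
  let f : V → PrimeSpectrum (MvPolynomial B ℂ ⧸ I) := fun x =>
    ⟨RingHom.ker (ev x), RingHom.ker_isPrime _⟩
  have hcomp : PrimeSpectrum.comap (Ideal.Quotient.mk I) ∘ f =
      (fun x => pointToPoint (k := ℂ) (b.equivFun x)) ∘ Subtype.val := by
    ext x p
    simp [f, ev, pointToPoint, mem_vanishingIdeal_iff, aeval_eq_eval, RingHom.mem_ker]
  have hind : Topology.IsInducing f := by
    rw [← (PrimeSpectrum.isClosedEmbedding_comap_of_surjective _ (Ideal.Quotient.mk I)
      Ideal.Quotient.mk_surjective).isInducing.of_comp_iff, hcomp]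
    exact (isInducing_pointToPoint b).comp Topology.IsInducing.subtypeVal
  refine topologicalKrullDim_eq_of_isInducing_of_closedPoints hind fun P hP => ?_
  rw [mem_closedPoints_iff, PrimeSpectrum.isClosed_singleton_iff_isMaximal] at hP
  have hmax : (P.asIdeal.comap (Ideal.Quotient.mk I)).IsMaximal :=
    Ideal.comap_isMaximal_of_surjective _ Ideal.Quotient.mk_surjective
  obtain ⟨y, hy⟩ := (isMaximal_iff_eq_vanishingIdeal_singleton).mp hmax
  have hyV : b.equivFun.symm y ∈ V := by
    rw [hV]
    intro p hp
    have : p ∈ P.asIdeal.comap (Ideal.Quotient.mk I) := by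
      rw [Ideal.mem_comap, Ideal.Quotient.eq_zero_iff_mem.mpr hp]
      exact zero_mem _
    rw [hy, mem_vanishingIdeal_iff] at this
    rw [LinearEquiv.apply_symm_apply]
    simpa [aeval_eq_eval] using this y rfl
  refine ⟨⟨_, hyV⟩, ?_⟩
  apply (PrimeSpectrum.isClosedEmbedding_comap_of_surjective _ (Ideal.Quotient.mk I)
      Ideal.Quotient.mk_surjective).injective
  have := congrFun hcomp ⟨_, hyV⟩
  rw [Function.comp_apply] at this
  rw [this]
  ext1
  change vanishingIdeal ℂ {b.equivFun (b.equivFun.symm y)} = _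
  rw [LinearEquiv.apply_symm_apply]
  exact hy.symm

end Zariski

theorem LinearIndependent.exists_dual_family {K V κ : Type*} [Field K] [AddCommGroup V]
    [Module K V] [DecidableEq κ] {v : κ → V} (hv : LinearIndependent K v) :
    ∃ l : κ → V →ₗ[K] K, ∀ i j, l i (v j) = if i = j then 1 else 0 := by
  obtain ⟨g, hg⟩ := LinearMap.exists_leftInverse_of_injective (Finsupp.linearCombination K v)
    (LinearMap.ker_eq_bot.mpr hv)
  refine ⟨fun i => Finsupp.lapply i ∘ₗ g, fun i j => ?_⟩
  have := LinearMap.congr_fun hg (Finsupp.single j 1)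
  simp only [LinearMap.comp_apply, Finsupp.linearCombination_single, one_smul,
    LinearMap.id_apply] at this
  rw [LinearMap.comp_apply, this, Finsupp.lapply_apply, Finsupp.single_apply]
  simp only [eq_comm]

section PolynomialMaps

variable {τ A : Type*} [CommRing A] [Algebra ℂ A]

/-- Evaluation of a polynomial with coefficients in `A` at a complex point. -/
def evalPt (z : τ → ℂ) : MvPolynomial τ A →+* A := eval fun s => algebraMap ℂ A (z s)

/-- The coefficientwise application of a linear functional. -/
def coeffMap (l : A →ₗ[ℂ] ℂ) (H : MvPolynomial τ A) : MvPolynomial τ ℂ :=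
  ∑ μ ∈ H.support, monomial μ (l (coeff μ H))

theorem coeff_coeffMap (l : A →ₗ[ℂ] ℂ) (H : MvPolynomial τ A) (μ : τ →₀ ℕ) :
    coeff μ (coeffMap l H) = l (coeff μ H) := by
  classical
  simp only [coeffMap, coeff_sum, coeff_monomial, Finset.sum_ite_eq', mem_support_iff]
  split_ifs with h
  · rfl
  · rw [not_not.mp h, map_zero]

theorem eval_coeffMap (l : A →ₗ[ℂ] ℂ) (H : MvPolynomial τ A) (z : τ → ℂ) :
    eval z (coeffMap l H) = l (evalPt z H) := by
  rw [coeffMap, map_sum, evalPt, eval_eq, map_sum]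
  refine Finset.sum_congr rfl fun μ _ => ?_
  rw [eval_monomial, Finsupp.prod]
  simp only [← map_pow, ← map_prod]
  rw [mul_comm (coeff μ H), ← Algebra.smul_def, map_smul, smul_eq_mul, mul_comm]

theorem pderiv_coeffMap (l : A →ₗ[ℂ] ℂ) (H : MvPolynomial τ A) (s : τ) :
    pderiv s (coeffMap l H) = coeffMap l (pderiv s H) := by
  ext μ
  rw [coeff_pderiv, coeff_coeffMap, coeff_coeffMap, coeff_pderiv]
  have : ((μ s : A) + 1) = algebraMap ℂ A (μ s + 1) := by simp
  rw [this, mul_comm (coeff _ H), ← Algebra.smul_def, map_smul, smul_eq_mul, mul_comm]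

end PolynomialMaps

/-- A property of points of an affine space is generic if it holds outside of the zero locus of
a nonzero polynomial. -/
def Generic {τ : Type*} (p : (τ → ℂ) → Prop) : Prop :=
  ∃ f : MvPolynomial τ ℂ, f ≠ 0 ∧ ∀ x, eval x f ≠ 0 → p x

namespace Generic

variable {τ : Type*} {p q : (τ → ℂ) → Prop}

theorem mono (hp : Generic p) (h : ∀ x, p x → q x) : Generic q :=
  hp.imp fun _ hf => ⟨hf.1, fun x hx => h x (hf.2 x hx)⟩

theorem and (hp : Generic p) (hq : Generic q) : Generic fun x => p x ∧ q x := by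
  obtain ⟨f, hf, hfp⟩ := hp
  obtain ⟨g, hg, hgq⟩ := hq
  refine ⟨f * g, mul_ne_zero hf hg, fun x hx => ?_⟩
  rw [map_mul] at hx
  exact ⟨hfp x (left_ne_zero_of_mul hx), hgq x (right_ne_zero_of_mul hx)⟩

theorem of_eval_ne_zero {f : MvPolynomial τ ℂ} {x : τ → ℂ} (hx : eval x f ≠ 0) :
    Generic fun x => eval x f ≠ 0 :=
  ⟨f, fun h => hx (by rw [h, map_zero]), fun _ h => h⟩

theorem finite_forall {ι : Type*} [Finite ι] {p : ι → (τ → ℂ) → Prop} (h : ∀ i, Generic (p i)) :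
    Generic fun x => ∀ i, p i x := by
  have := Fintype.ofFinite ι
  choose f hf hfp using h
  refine ⟨∏ i, f i, Finset.prod_ne_zero_iff.mpr fun i _ => hf i, fun x hx i => ?_⟩
  rw [map_prod] at hx
  exact hfp i x (Finset.prod_ne_zero_iff.mp hx i (Finset.mem_univ i))

theorem exists_point (hp : Generic p) : ∃ x, p x := by
  obtain ⟨f, hf, hfp⟩ := hp
  by_contra! h
  exact hf (MvPolynomial.funext fun x => by
    rw [map_zero]
    by_contra hx
    exact h x (hfp x hx))

/-- A polynomial vanishing at a generic point vanishes. -/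
theorem eq_zero (f : MvPolynomial τ ℂ) (h : Generic fun x => eval x f = 0) : f = 0 := by
  by_contra hf
  obtain ⟨x, hx, hx'⟩ :=
    (h.and ⟨f, hf, fun _ h => h⟩ : Generic fun x => _ ∧ eval x f ≠ 0).exists_point
  exact hx' hx

/-- Lower semicontinuity of the rank of a finite polynomial family of vectors. -/
theorem finrank_span_le {A J : Type*} [CommRing A] [Algebra ℂ A] [Finite J]
    (H : J → MvPolynomial τ A) (z₀ : τ → ℂ) :
    Generic fun z => Module.finrank ℂ (Submodule.span ℂ (Set.range fun j => evalPt z₀ (H j))) ≤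
      Module.finrank ℂ (Submodule.span ℂ (Set.range fun j => evalPt z (H j))) := by
  classical
  obtain ⟨κ, a, ha, hspan, hli⟩ := exists_linearIndependent' ℂ (fun j => evalPt z₀ (H j))
  have : Finite κ := Finite.of_injective a ha
  have := Fintype.ofFinite κ
  rw [← hspan, finrank_span_eq_card hli]
  obtain ⟨l, hl⟩ := hli.exists_dual_family
  let f : MvPolynomial τ ℂ := (Matrix.of fun i j => coeffMap (l i) (H (a j))).det
  have hf : ∀ z, eval z f = (Matrix.of fun i j => l i (evalPt z (H (a j)))).det := by
    intro z
    rw [RingHom.map_det]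
    congr 1
    ext i j
    simp [eval_coeffMap]
  have hf0 : eval z₀ f ≠ 0 := by
    rw [hf]
    have : (Matrix.of fun i j => l i (evalPt z₀ (H (a j)))) = 1 := by
      ext i j
      simpa [Matrix.one_apply] using hl i j
    rw [this]; simp
  refine (of_eval_ne_zero hf0).mono fun z hz => ?_
  rw [hf] at hz
  have hli' : LinearIndependent ℂ (fun i => evalPt z (H (a i))) := by
    rw [Fintype.linearIndependent_iff]
    intro g hg
    refine congrFun (Matrix.eq_zero_of_mulVec_eq_zero hz ?_)
    ext i
    have := congrArg (l i) hg
    simpa [Matrix.mulVec, dotProduct, mul_comm] using this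
  rw [← finrank_span_eq_card hli']
  have := FiniteDimensional.span_of_finite ℂ (Set.finite_range fun j => evalPt z (H j))
  exact Submodule.finrank_mono (Submodule.span_mono (by rintro _ ⟨i, rfl⟩; exact ⟨a i, rfl⟩))

end Generic

section MultiHomogeneous

variable {t : ℕ} {n : Fin t → ℕ}

/-- The multidegree-`d` exponents. -/
def multiExponents (n d : Fin t → ℕ) : Set (((i : Fin t) × Fin (n i)) →₀ ℕ) :=
  { μ | ∀ i, ∑ j, μ ⟨i, j⟩ = d i }

theorem multiHomogeneousSubmodule_eq_restrictSupport (d : Fin t → ℕ) :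
    multiHomogeneousSubmodule t n d = restrictSupport ℂ (multiExponents n d) := by
  ext f
  rw [mem_restrictSupport_iff]
  exact forall_congr' fun μ => by rw [Finset.mem_coe, mem_support_iff]; rfl

/-- Multidegree-`d` exponents are tuples of multisets. -/
def multiExponentsEquiv (d : Fin t → ℕ) :
    multiExponents n d ≃ ((i : Fin t) → Sym (Fin (n i)) (d i)) :=
  ((Finsupp.equivFunOnFinite.trans (Equiv.piCurry fun _ _ => ℕ)).subtypeEquiv
    (p := fun μ => μ ∈ multiExponents n d) (q := fun g => ∀ i, ∑ j, g i j = d i) fun _ => Iff.rfl).trans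
    ((Equiv.subtypePiEquivPi (p := fun i (g : Fin (n i) → ℕ) => ∑ j, g j = d i)).trans
    (Equiv.piCongrRight fun i => (Sym.equivNatSumOfFintype (Fin (n i)) (d i)).symm))

instance (d : Fin t → ℕ) : Finite (multiExponents n d) :=
  Finite.of_equiv _ (multiExponentsEquiv d).symm

instance (d : Fin t → ℕ) : FiniteDimensional ℂ (multiHomogeneousSubmodule t n d) := by
  rw [multiHomogeneousSubmodule_eq_restrictSupport]
  exact (basisRestrictSupport ℂ (multiExponents n d)).finiteDimensional_of_finite

theorem finrank_multiHomogeneousSubmodule (d : Fin t → ℕ) :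
    Module.finrank ℂ (multiHomogeneousSubmodule t n d) =
      ∏ i, (n i + d i - 1).choose (d i) := by
  rw [multiHomogeneousSubmodule_eq_restrictSupport,
    Module.finrank_eq_nat_card_basis (basisRestrictSupport ℂ (multiExponents n d)),
    Nat.card_congr (multiExponentsEquiv d), Nat.card_pi]
  exact Finset.prod_congr rfl fun i _ => by
    rw [Nat.card_eq_fintype_card, Sym.card_sym_eq_choose, Fintype.card_fin]

theorem mul_mem_multiHomogeneousSubmodule {d e : Fin t → ℕ}
    {f g : MvPolynomial ((i : Fin t) × Fin (n i)) ℂ} (hf : f ∈ multiHomogeneousSubmodule t n d)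
    (hg : g ∈ multiHomogeneousSubmodule t n e) :
    f * g ∈ multiHomogeneousSubmodule t n (d + e) := by
  classical
  intro μ hμ i
  rw [coeff_mul] at hμ
  obtain ⟨⟨a, b⟩, hab, hne⟩ := Finset.exists_ne_zero_of_sum_ne_zero hμ
  rw [← Finset.HasAntidiagonal.mem_antidiagonal.mp hab]
  simp only [Finsupp.add_apply, Finset.sum_add_distrib, Pi.add_apply]
  rw [hf a (left_ne_zero_of_mul hne), hg b (right_ne_zero_of_mul hne)]

theorem one_mem_multiHomogeneousSubmodule :
    (1 : MvPolynomial ((i : Fin t) × Fin (n i)) ℂ) ∈ multiHomogeneousSubmodule t n 0 := by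
  classical
  intro μ hμ i
  rw [coeff_one] at hμ
  have : μ = 0 := by
    by_contra h
    exact hμ (if_neg (Ne.symm h))
  simp [this]

theorem X_mem_multiHomogeneousSubmodule (s : (i : Fin t) × Fin (n i)) :
    (X s : MvPolynomial ((i : Fin t) × Fin (n i)) ℂ) ∈
      multiHomogeneousSubmodule t n (Pi.single s.1 1) := by
  classical
  intro μ hμ i
  rw [coeff_X] at hμ
  have : Finsupp.single s 1 = μ := by
    by_contra h
    exact hμ (if_neg h)
  obtain ⟨k, l⟩ := s
  rw [← this]
  by_cases h : k = i
  · subst h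
    simp [Finsupp.single_apply]
  · simp [Ne.symm h]

theorem pow_mem_multiHomogeneousSubmodule {d : Fin t → ℕ}
    {f : MvPolynomial ((i : Fin t) × Fin (n i)) ℂ} (hf : f ∈ multiHomogeneousSubmodule t n d)
    (k : ℕ) : f ^ k ∈ multiHomogeneousSubmodule t n (k • d) := by
  induction k with
  | zero => simpa using one_mem_multiHomogeneousSubmodule
  | succ k ih => rw [pow_succ, succ_nsmul]; exact mul_mem_multiHomogeneousSubmodule ih hf

theorem prod_mem_multiHomogeneousSubmodule {ι : Type*} (S : Finset ι) (d : ι → Fin t → ℕ)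
    (f : ι → MvPolynomial ((i : Fin t) × Fin (n i)) ℂ)
    (hf : ∀ i, f i ∈ multiHomogeneousSubmodule t n (d i)) :
    ∏ i ∈ S, f i ∈ multiHomogeneousSubmodule t n (∑ i ∈ S, d i) := by
  classical
  induction S using Finset.induction_on with
  | empty => simpa using one_mem_multiHomogeneousSubmodule
  | insert a S ha ih =>
    rw [Finset.prod_insert ha, Finset.sum_insert ha]
    exact mul_mem_multiHomogeneousSubmodule (hf a) ih

/-- The product of powers of the pairings of the groups of variables of `y` and `x`. -/
def segre {R : Type*} [CommSemiring R] (y x : (i : Fin t) × Fin (n i) → R) (e : Fin t → ℕ) : R :=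
  ∏ i, (∑ j, y ⟨i, j⟩ * x ⟨i, j⟩) ^ e i

theorem map_segre {R S : Type*} [CommSemiring R] [CommSemiring S] (f : R →+* S)
    (y x : (i : Fin t) × Fin (n i) → R) (e : Fin t → ℕ) :
    f (segre y x e) = segre (fun s => f (y s)) (fun s => f (x s)) e := by
  simp [segre]

/-- The product of powers of linear forms with coefficient vector `q`. -/
def mono (q : (i : Fin t) × Fin (n i) → ℂ) (e : Fin t → ℕ) :
    MvPolynomial ((i : Fin t) × Fin (n i)) ℂ :=
  segre (fun s => C (q s)) X e

theorem mono_mem (q : (i : Fin t) × Fin (n i) → ℂ) (e : Fin t → ℕ) :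
    mono q e ∈ multiHomogeneousSubmodule t n e := by
  have h := prod_mem_multiHomogeneousSubmodule Finset.univ (fun i => e i • Pi.single i 1)
    (fun i => (∑ j, C (q ⟨i, j⟩) * X ⟨i, j⟩ : MvPolynomial ((i : Fin t) × Fin (n i)) ℂ) ^ e i)
    fun i => pow_mem_multiHomogeneousSubmodule (Submodule.sum_mem _ fun j _ => by
      rw [← smul_eq_C_mul]
      exact Submodule.smul_mem _ _ (X_mem_multiHomogeneousSubmodule ⟨i, j⟩)) _
  have he : ∑ i, e i • Pi.single i 1 = e := by
    ext k
    simp [Finset.sum_apply, Pi.single_apply]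
  rwa [he] at h

/-- The derivative, up to a scalar, of `mono · d` in the direction `s`. -/
def tangentVector (d : Fin t → ℕ) (q : (i : Fin t) × Fin (n i) → ℂ)
    (s : (i : Fin t) × Fin (n i)) : MvPolynomial ((i : Fin t) × Fin (n i)) ℂ :=
  X s * mono q (d - Pi.single s.1 1)

theorem sub_single_add_single {d : Fin t → ℕ} (hd : ∀ i, 1 ≤ d i) (i : Fin t) :
    d - Pi.single i 1 + Pi.single i 1 = d := by
  refine tsub_add_cancel_of_le fun k => ?_
  by_cases h : k = i
  · subst h; simpa using hd k
  · simp [h]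

theorem tangentVector_mem {d : Fin t → ℕ} (hd : ∀ i, 1 ≤ d i)
    (q : (i : Fin t) × Fin (n i) → ℂ) (s : (i : Fin t) × Fin (n i)) :
    tangentVector d q s ∈ multiHomogeneousSubmodule t n d := by
  have := mul_mem_multiHomogeneousSubmodule (X_mem_multiHomogeneousSubmodule s)
    (mono_mem q (d - Pi.single s.1 1))
  rwa [add_comm, sub_single_add_single hd] at this

/-- The affine tangent space of the Segre–Veronese variety. -/
def tangentSpan (d : Fin t → ℕ) (q : (i : Fin t) × Fin (n i) → ℂ) :
    Submodule ℂ (MvPolynomial ((i : Fin t) × Fin (n i)) ℂ) :=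
  Submodule.span ℂ (Set.range (tangentVector d q))

/-- The sum of the tangent spaces at the points of a configuration indexed by `S`. -/
def tangentSum {ι : Type*} (d : Fin t → ℕ) (S : Finset ι)
    (z : ι × ((i : Fin t) × Fin (n i)) → ℂ) :
    Submodule ℂ (MvPolynomial ((i : Fin t) × Fin (n i)) ℂ) :=
  ⨆ e ∈ S, tangentSpan d fun s => z (e, s)

theorem tangentSpan_le {d : Fin t → ℕ} (hd : ∀ i, 1 ≤ d i) (q : (i : Fin t) × Fin (n i) → ℂ) :
    tangentSpan d q ≤ multiHomogeneousSubmodule t n d := by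
  rw [tangentSpan, Submodule.span_le]
  rintro _ ⟨s, rfl⟩
  exact tangentVector_mem hd q s

theorem tangentSum_le {ι : Type*} {d : Fin t → ℕ} (hd : ∀ i, 1 ≤ d i) (S : Finset ι)
    (z : ι × ((i : Fin t) × Fin (n i)) → ℂ) :
    tangentSum d S z ≤ multiHomogeneousSubmodule t n d :=
  iSup₂_le fun _ _ => tangentSpan_le hd _

theorem tangentSum_eq_span {ι : Type*} (d : Fin t → ℕ) (S : Finset ι)
    (z : ι × ((i : Fin t) × Fin (n i)) → ℂ) :
    tangentSum d S z = Submodule.span ℂ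
      (Set.range fun p : S × ((i : Fin t) × Fin (n i)) =>
        tangentVector d (fun s => z (p.1, s)) p.2) := by
  simp only [tangentSum, tangentSpan, ← Submodule.span_iUnion]
  congr 1
  ext v
  simp

/-- Multiplicativity of the relation of being a summand. -/
theorem exists_prod_eq_prod_add {R ι : Type*} [CommSemiring R] (S : Finset ι) (a b : ι → R)
    (h : ∀ i, ∃ r, b i = a i + r) : ∃ r, ∏ i ∈ S, b i = ∏ i ∈ S, a i + r := by
  classical
  induction S using Finset.induction_on with
  | empty => exact ⟨0, by simp⟩
  | insert i S hi ih =>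
    obtain ⟨r, hr⟩ := h i
    obtain ⟨r', hr'⟩ := ih
    refine ⟨a i * r' + r * (∏ i ∈ S, a i + r'), ?_⟩
    rw [Finset.prod_insert hi, Finset.prod_insert hi, hr, hr']
    ring

theorem coeff_segre_one_ne_zero {d : Fin t → ℕ} {μ : ((i : Fin t) × Fin (n i)) →₀ ℕ}
    (hμ : μ ∈ multiExponents n d) :
    coeff μ (segre X 1 d : MvPolynomial ((i : Fin t) × Fin (n i)) ℂ) ≠ 0 := by
  classical
  have hmap : (segre X 1 d : MvPolynomial ((i : Fin t) × Fin (n i)) ℂ) =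
      map (Nat.castRingHom ℂ) (segre X 1 d) := by
    rw [map_segre]
    congr 1
    · ext1 s; simp
    · ext1 s; simp
  obtain ⟨r, hr⟩ : ∃ r, (segre X 1 d : MvPolynomial ((i : Fin t) × Fin (n i)) ℕ) =
      monomial μ 1 + r := by
    have h := exists_prod_eq_prod_add Finset.univ
      (fun i => ∏ j, (X ⟨i, j⟩ : MvPolynomial ((i : Fin t) × Fin (n i)) ℕ) ^ μ ⟨i, j⟩)
      (fun i => (∑ j, X ⟨i, j⟩) ^ d i) fun i => by
        rw [← hμ i, ← Finset.prod_pow_eq_pow_sum]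
        refine exists_prod_eq_prod_add _ _ _ fun j => ?_
        rw [← Finset.card_range (μ ⟨i, j⟩), ← Finset.prod_const, ← Finset.prod_const]
        refine exists_prod_eq_prod_add _ _ _ fun _ => ?_
        exact ⟨_, (Finset.add_sum_erase _ _ (Finset.mem_univ j)).symm⟩
    obtain ⟨r, hr⟩ := h
    refine ⟨r, ?_⟩
    rw [monomial_eq, Finsupp.prod_fintype _ _ (by simp), Fintype.prod_sigma, map_one, one_mul,
      ← hr]
    simp [segre]
  rw [hmap, coeff_map, hr]
  simp
  norm_cast
  omega

theorem coeff_aeval_X_mul_C_X {σ : Type*} (p : MvPolynomial σ ℂ) (μ : σ →₀ ℕ) :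
    coeff μ (aeval (fun s => (X s * C (X s) : MvPolynomial σ (MvPolynomial σ ℂ))) p) =
      coeff μ p • monomial μ 1 := by
  classical
  induction p using MvPolynomial.induction_on' with
  | monomial ν a =>
    have h : (ν.prod fun i k => (X i * C (X i) : MvPolynomial σ (MvPolynomial σ ℂ)) ^ k) =
        monomial ν (monomial ν 1) := by
      simp only [mul_pow, Finsupp.prod_mul]
      rw [monomial_eq (a := monomial ν 1), monomial_eq (a := (1 : ℂ)), mul_comm, map_one, one_mul]
      simp only [Finsupp.prod, map_prod, map_pow]
    rw [aeval_monomial, h, ← Algebra.smul_def, coeff_smul, coeff_monomial, coeff_monomial]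
    split_ifs with hν
    · rw [hν]
    · simp
  | add p q hp hq => rw [map_add, coeff_add, hp, hq, coeff_add, add_smul]

/-- The powers of products of linear forms span the multihomogeneous polynomials. -/
theorem span_range_mono (d : Fin t → ℕ) :
    Submodule.span ℂ (Set.range fun q => mono (n := n) q d) =
      multiHomogeneousSubmodule t n d := by
  classical
  refine le_antisymm (Submodule.span_le.mpr (by rintro _ ⟨q, rfl⟩; exact mono_mem q d)) ?_
  rw [multiHomogeneousSubmodule_eq_restrictSupport, restrictSupport_eq_span, Submodule.span_le]
  rintro _ ⟨μ, hμ, rfl⟩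
  by_contra hv
  obtain ⟨l, hl, hl0⟩ := Submodule.exists_dual_map_eq_bot_of_notMem hv inferInstance
  have hl' : ∀ q, l (mono q d) = 0 := fun q => by
    have : l (mono q d) ∈ Submodule.map l (Submodule.span ℂ (Set.range fun q => mono q d)) :=
      Submodule.mem_map_of_mem (Submodule.subset_span ⟨q, rfl⟩)
    rwa [hl0, Submodule.mem_bot] at this
  let G : MvPolynomial ((i : Fin t) × Fin (n i)) (MvPolynomial ((i : Fin t) × Fin (n i)) ℂ) :=
    segre X (fun s => C (X s)) d
  have hG : coeffMap l G = 0 := MvPolynomial.funext fun z => by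
    rw [eval_coeffMap, map_zero, ← hl' z, evalPt, map_segre]
    simp [mono, algebraMap_eq]
  have hc : coeff μ G = coeff μ (segre X 1 d : MvPolynomial ((i : Fin t) × Fin (n i)) ℂ) •
      monomial μ 1 := by
    rw [← coeff_aeval_X_mul_C_X, ← AlgHom.coe_toRingHom, map_segre]
    simp [G, segre]
  have := congrArg (coeff μ) hG
  rw [coeff_coeffMap, hc, map_smul, coeff_zero, smul_eq_mul] at this
  exact (mul_ne_zero (coeff_segre_one_ne_zero hμ) hl) this

end MultiHomogeneous

section TangentRank

variable {t : ℕ} {n : Fin t → ℕ}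

/-- The maximal dimension of a sum of `k` tangent spaces. -/
def tangentRank (n d : Fin t → ℕ) (k : ℕ) : ℕ :=
  sSup (Set.range fun z : Fin k × ((i : Fin t) × Fin (n i)) → ℂ =>
    Module.finrank ℂ (tangentSum d Finset.univ z))

variable {d : Fin t → ℕ}

theorem finiteDimensional_of_le {V : Submodule ℂ (MvPolynomial ((i : Fin t) × Fin (n i)) ℂ)}
    (h : V ≤ multiHomogeneousSubmodule t n d) : FiniteDimensional ℂ V :=
  Submodule.finiteDimensional_of_le h

theorem finrank_tangentSum_le {ι : Type*} (hd : ∀ i, 1 ≤ d i) (S : Finset ι)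
    (z : ι × ((i : Fin t) × Fin (n i)) → ℂ) :
    Module.finrank ℂ (tangentSum d S z) ≤ Module.finrank ℂ (multiHomogeneousSubmodule t n d) :=
  Submodule.finrank_mono (tangentSum_le hd S z)

theorem bddAbove_range_finrank_tangentSum (hd : ∀ i, 1 ≤ d i) (k : ℕ) :
    BddAbove (Set.range fun z : Fin k × ((i : Fin t) × Fin (n i)) → ℂ =>
      Module.finrank ℂ (tangentSum d Finset.univ z)) :=
  ⟨_, by rintro _ ⟨z, rfl⟩; exact finrank_tangentSum_le hd _ z⟩

theorem exists_finrank_tangentSum_eq (hd : ∀ i, 1 ≤ d i) (k : ℕ) :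
    ∃ z : Fin k × ((i : Fin t) × Fin (n i)) → ℂ,
      Module.finrank ℂ (tangentSum d Finset.univ z) = tangentRank n d k :=
  Nat.sSup_mem (Set.range_nonempty _) (bddAbove_range_finrank_tangentSum hd k)

theorem tangentRank_le (hd : ∀ i, 1 ≤ d i) (k : ℕ) :
    tangentRank n d k ≤ Module.finrank ℂ (multiHomogeneousSubmodule t n d) := by
  obtain ⟨z, hz⟩ := exists_finrank_tangentSum_eq (n := n) hd k
  exact hz ▸ finrank_tangentSum_le hd _ z

theorem tangentSum_relabel {ι : Type*} {k : ℕ} (S : Finset ι) (e : S ≃ Fin k)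
    (z : ι × ((i : Fin t) × Fin (n i)) → ℂ) (z' : Fin k × ((i : Fin t) × Fin (n i)) → ℂ)
    (h : ∀ a s, z' (e a, s) = z (a, s)) : tangentSum d Finset.univ z' = tangentSum d S z := by
  simp only [tangentSum, Finset.mem_univ, iSup_pos]
  rw [iSup_subtype', ← e.iSup_comp]
  simp only [h]

theorem finrank_tangentSum_le_tangentRank {ι : Type*} (hd : ∀ i, 1 ≤ d i) (S : Finset ι)
    (z : ι × ((i : Fin t) × Fin (n i)) → ℂ) :
    Module.finrank ℂ (tangentSum d S z) ≤ tangentRank n d S.card := by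
  rw [← tangentSum_relabel S S.equivFin z (fun p => z (S.equivFin.symm p.1, p.2))
    fun a s => by simp]
  exact le_csSup (bddAbove_range_finrank_tangentSum hd _) ⟨_, rfl⟩

theorem generic_finrank_tangentSum {ι : Type*} (hd : ∀ i, 1 ≤ d i) (S : Finset ι) :
    Generic fun z : ι × ((i : Fin t) × Fin (n i)) → ℂ =>
      Module.finrank ℂ (tangentSum d S z) = tangentRank n d S.card := by
  classical
  let H (p : S × ((i : Fin t) × Fin (n i))) : MvPolynomial (ι × ((i : Fin t) × Fin (n i)))
      (MvPolynomial ((i : Fin t) × Fin (n i)) ℂ) :=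
    C (X p.2) * segre (fun s => X (p.1.1, s)) (fun s => C (X s)) (d - Pi.single p.2.1 1)
  have hH : ∀ z p, evalPt z (H p) = tangentVector d (fun s => z (p.1, s)) p.2 := by
    intro z p
    rw [evalPt, map_mul, map_segre, tangentVector, mono]
    simp [algebraMap_eq]
  obtain ⟨z', hz'⟩ := exists_finrank_tangentSum_eq (n := n) hd S.card
  let z₀ : ι × ((i : Fin t) × Fin (n i)) → ℂ := fun p =>
    if h : p.1 ∈ S then z' (S.equivFin ⟨p.1, h⟩, p.2) else 0
  have h₀ := tangentSum_relabel (d := d) S S.equivFin z₀ z' fun a s => by simp [z₀]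
  have hW : ∀ z, tangentSum d S z = Submodule.span ℂ (Set.range fun p => evalPt z (H p)) :=
    fun z => by simp only [tangentSum_eq_span, hH]
  refine (Generic.finrank_span_le H z₀).mono fun z hz => ?_
  rw [← hW, ← hW, ← h₀, hz'] at hz
  exact le_antisymm (finrank_tangentSum_le_tangentRank hd S z) hz

theorem tangentRank_zero (hd : ∀ i, 1 ≤ d i) : tangentRank n d 0 = 0 := by
  obtain ⟨z, hz⟩ := exists_finrank_tangentSum_eq (n := n) hd 0
  rw [← hz, show tangentSum d Finset.univ z = ⊥ by simp [tangentSum], finrank_bot]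

theorem tangentSum_mono {ι : Type*} {S S' : Finset ι} (h : S ⊆ S')
    (z : ι × ((i : Fin t) × Fin (n i)) → ℂ) : tangentSum d S z ≤ tangentSum d S' z :=
  biSup_mono h

/-- The coordinates on a chart of the product of projective spaces, together with a scale. -/
abbrev ChartIndex (n : Fin t → ℕ) (i₀ : Fin t) : Type :=
  { s : (i : Fin t) × Fin (n i) // ¬ (s.1 ≠ i₀ ∧ s.2.val = 0) }

theorem card_chartIndex (hn : ∀ i, 1 ≤ n i) (i₀ : Fin t) :
    Fintype.card (ChartIndex n i₀) = (∑ i, n i) - t + 1 := by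
  have e : { s : (i : Fin t) × Fin (n i) // s.1 ≠ i₀ ∧ s.2.val = 0 } ≃ { i : Fin t // i ≠ i₀ } :=
    { toFun := fun s => ⟨s.1.1, s.2.1⟩
      invFun := fun i => ⟨⟨i, ⟨0, hn i⟩⟩, i.2, rfl⟩
      left_inv := by
        rintro ⟨⟨i, j⟩, h, h'⟩
        simp only [Subtype.mk.injEq, Sigma.mk.injEq, heq_eq_eq, true_and]
        exact Fin.ext h'.symm
      right_inv := fun _ => rfl }
  rw [Fintype.card_subtype_compl, Fintype.card_congr e, Fintype.card_sigma]
  simp only [Fintype.card_fin, ne_eq, Fintype.card_subtype_compl, Fintype.card_subtype_eq]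
  have h1 : t ≤ ∑ i, n i := by
    calc t = ∑ _i : Fin t, 1 := by simp
      _ ≤ _ := Finset.sum_le_sum fun i _ => hn i
  have h2 := i₀.pos
  omega

theorem le_tangentRank_one (hn : ∀ i, 1 ≤ n i) (hd : ∀ i, 1 ≤ d i) (i₀ : Fin t) :
    (∑ i, n i) - t + 1 ≤ tangentRank n d 1 := by
  classical
  let q : (i : Fin t) × Fin (n i) → ℂ := fun s => if s.2.val = 0 then 1 else 0
  let ν (e : Fin t → ℕ) : ((i : Fin t) × Fin (n i)) →₀ ℕ :=
    ∑ i, Finsupp.single ⟨i, ⟨0, hn i⟩⟩ (e i)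
  have hq : ∀ e, mono q e = monomial (ν e) 1 := by
    intro e
    rw [mono, segre, monomial_sum_one]
    refine Finset.prod_congr rfl fun i _ => ?_
    rw [← X_pow_eq_monomial, Finset.sum_eq_single ⟨0, hn i⟩]
    · simp [q]
    · intro j _ hj
      have : j.val ≠ 0 := fun h => hj (Fin.ext h)
      simp [q, this]
    · simp
  have hν : ∀ e (s : (i : Fin t) × Fin (n i)), s.2.val ≠ 0 → ν e s = 0 := by
    rintro e ⟨i, j⟩ h
    simp only [ν, Finsupp.finsetSum_apply]
    refine Finset.sum_eq_zero fun k _ => Finsupp.single_eq_of_ne ?_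
    rintro ⟨⟩
    exact h rfl
  let μ (s : ChartIndex n i₀) := Finsupp.single s.1 1 + ν (d - Pi.single s.1.1 1)
  have hμ : Function.Injective μ := by
    have key : ∀ s s' : ChartIndex n i₀, μ s = μ s' → s.1.2.val ≠ 0 → s = s' := by
      intro s s' h hs
      have := DFunLike.congr_fun h s.1
      simp only [μ, Finsupp.add_apply, hν _ _ hs, Finsupp.single_eq_same, add_zero,
        Finsupp.single_apply] at this
      split_ifs at this with h'
      exact Subtype.ext h'.symm
    intro s s' h
    by_cases hs : s.1.2.val = 0
    · by_cases hs' : s'.1.2.val = 0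
      · obtain ⟨⟨i, j⟩, hij⟩ := s
        obtain ⟨⟨i', j'⟩, hij'⟩ := s'
        simp only at hs hs'
        obtain rfl : i = i₀ := by simpa [hs] using hij
        obtain rfl : i' = i := by simpa [hs'] using hij'
        obtain rfl : j = j' := Fin.ext (hs.trans hs'.symm)
        rfl
      · exact (key s' s h.symm hs').symm
    · exact key s s' h hs
  have htv : ∀ s : ChartIndex n i₀, tangentVector d q s.1 = monomial (μ s) 1 := by
    intro s
    rw [tangentVector, hq, X, monomial_mul, one_mul]
  have hli : LinearIndependent ℂ fun s : ChartIndex n i₀ => tangentVector d q s.1 := by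
    simp only [htv]
    exact (basisMonomials _ ℂ).linearIndependent.comp μ hμ
  rw [← card_chartIndex hn i₀, ← finrank_span_eq_card hli]
  refine le_trans ?_ (finrank_tangentSum_le_tangentRank hd (Finset.univ : Finset (Fin 1))
    fun p => q p.2)
  have := finiteDimensional_of_le (tangentSum_le hd (Finset.univ : Finset (Fin 1))
    fun p => q p.2)
  refine Submodule.finrank_mono ?_
  rw [Submodule.span_le]
  rintro _ ⟨s, rfl⟩
  simp only [tangentSum, Finset.mem_univ, iSup_pos, ciSup_unique]
  exact Submodule.subset_span ⟨s.1, rfl⟩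

end TangentRank

section Degeneration

variable {t : ℕ} {n : Fin t → ℕ} {d : Fin t → ℕ}

/-- The pairing of the `i`-th groups of coordinates. -/
def groupPairing (a q : (i : Fin t) × Fin (n i) → ℂ) (i : Fin t) : ℂ := ∑ j, a ⟨i, j⟩ * q ⟨i, j⟩

/-- The groupwise linear map `s • id + a ⊗ b` on coefficient vectors. -/
def shear (a b : (i : Fin t) × Fin (n i) → ℂ) (s : ℂ) (q : (i : Fin t) × Fin (n i) → ℂ) :
    (i : Fin t) × Fin (n i) → ℂ :=
  fun x => s * q x + groupPairing a q x.1 * b x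

/-- The adjugate of `shear a b s`. -/
def coshear (a b : (i : Fin t) × Fin (n i) → ℂ) (s : ℂ) (q : (i : Fin t) × Fin (n i) → ℂ) :
    (i : Fin t) × Fin (n i) → ℂ :=
  fun x => (s + groupPairing a b x.1) * q x - groupPairing a q x.1 * b x

theorem shear_coshear (a b : (i : Fin t) × Fin (n i) → ℂ) (s : ℂ)
    (q : (i : Fin t) × Fin (n i) → ℂ) :
    shear a b s (coshear a b s q) = fun x => s * (s + groupPairing a b x.1) * q x := by
  ext x
  have : groupPairing a (coshear a b s q) x.1 = s * groupPairing a q x.1 := by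
    have h : ∀ i, groupPairing a (coshear a b s q) i = (s + groupPairing a b i) *
        groupPairing a q i - groupPairing a q i * groupPairing a b i := by
      intro i
      rw [groupPairing, groupPairing, groupPairing, Finset.mul_sum, Finset.mul_sum,
        ← Finset.sum_sub_distrib]
      refine Finset.sum_congr rfl fun j _ => ?_
      simp only [coshear, groupPairing]
      ring
    rw [h]; ring
  rw [shear, this, coshear]
  ring

theorem coshear_shear (a b : (i : Fin t) × Fin (n i) → ℂ) (s : ℂ)
    (q : (i : Fin t) × Fin (n i) → ℂ) :
    coshear a b s (shear a b s q) = fun x => s * (s + groupPairing a b x.1) * q x := by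
  ext x
  have : groupPairing a (shear a b s q) x.1 =
      s * groupPairing a q x.1 + groupPairing a q x.1 * groupPairing a b x.1 := by
    simp only [groupPairing, Finset.mul_sum, ← Finset.sum_add_distrib]
    refine Finset.sum_congr rfl fun j _ => ?_
    simp only [shear, groupPairing]
    simp only [Finset.sum_mul, mul_add, Finset.mul_sum]
    congr 1
    · ring
    · refine Finset.sum_congr rfl fun j _ => ?_
      ring
  rw [coshear, this, shear]
  ring

/-- The linear form with coefficients `b` in the `i`-th group of variables. -/
def linForm (b : (i : Fin t) × Fin (n i) → ℂ) (i : Fin t) :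
    MvPolynomial ((i : Fin t) × Fin (n i)) ℂ :=
  ∑ j, C (b ⟨i, j⟩) * X ⟨i, j⟩

/-- The substitution on polynomials dual to `shear`. -/
def shearHom (a b : (i : Fin t) × Fin (n i) → ℂ) (s : ℂ) :
    MvPolynomial ((i : Fin t) × Fin (n i)) ℂ →ₐ[ℂ] MvPolynomial ((i : Fin t) × Fin (n i)) ℂ :=
  aeval fun x => C s * X x + C (a x) * linForm b x.1

theorem shearHom_mono (a b : (i : Fin t) × Fin (n i) → ℂ) (s : ℂ)
    (q : (i : Fin t) × Fin (n i) → ℂ) (e : Fin t → ℕ) :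
    shearHom a b s (mono q e) = mono (shear a b s q) e := by
  simp only [mono, segre, map_prod, map_pow]
  refine Finset.prod_congr rfl fun i _ => congrArg (· ^ e i) ?_
  have h1 : ∀ j, shearHom a b s (C (q ⟨i, j⟩) * X ⟨i, j⟩) = C (s * q ⟨i, j⟩) * X ⟨i, j⟩ +
        C (a ⟨i, j⟩ * q ⟨i, j⟩) * linForm b i := by
    intro j
    simp only [shearHom, aeval_X, algHom_C, algebraMap_eq, map_mul]
    ring
  have h2 : ∀ j, C (shear a b s q ⟨i, j⟩) * X ⟨i, j⟩ =
      (C (s * q ⟨i, j⟩) * X ⟨i, j⟩ + C (groupPairing a q i) * (C (b ⟨i, j⟩) * X ⟨i, j⟩) :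
        MvPolynomial ((i : Fin t) × Fin (n i)) ℂ) := by
    intro j
    simp only [shear, map_add, map_mul]
    ring
  rw [map_sum, Finset.sum_congr rfl fun j _ => h1 j, Finset.sum_congr rfl fun j _ => h2 j,
    Finset.sum_add_distrib, Finset.sum_add_distrib, ← Finset.sum_mul, ← Finset.mul_sum,
    groupPairing, map_sum, linForm]

theorem X_mul_mono_mem (q : (i : Fin t) × Fin (n i) → ℂ) (i : Fin t) (j : Fin (n i)) :
    X ⟨i, j⟩ * mono q (d - Pi.single i 1) ∈ tangentSpan d q :=
  Submodule.subset_span ⟨⟨i, j⟩, rfl⟩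

theorem map_shearHom_tangentSpan_le (a b : (i : Fin t) × Fin (n i) → ℂ) (s : ℂ)
    (q : (i : Fin t) × Fin (n i) → ℂ) :
    (tangentSpan d q).map (shearHom a b s).toLinearMap ≤ tangentSpan d (shear a b s q) := by
  rw [tangentSpan, Submodule.map_span, Submodule.span_le]
  rintro _ ⟨_, ⟨⟨i, j⟩, rfl⟩, rfl⟩
  simp only [AlgHom.toLinearMap_apply, SetLike.mem_coe, tangentVector, map_mul, shearHom_mono]
  rw [shearHom, aeval_X, add_mul, mul_assoc, mul_assoc, linForm, Finset.sum_mul, ← smul_eq_C_mul,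
    ← smul_eq_C_mul]
  refine Submodule.add_mem _ (Submodule.smul_mem _ _ (X_mul_mono_mem _ i j))
    (Submodule.smul_mem _ _ (Submodule.sum_mem _ fun k _ => ?_))
  rw [mul_assoc, ← smul_eq_C_mul]
  exact Submodule.smul_mem _ _ (X_mul_mono_mem _ i k)

theorem mono_scale (c : Fin t → ℂ) (q : (i : Fin t) × Fin (n i) → ℂ) (e : Fin t → ℕ) :
    mono (fun x => c x.1 * q x) e = (∏ i, c i ^ e i) • mono q e := by
  simp only [mono, segre, smul_eq_C_mul, map_prod, map_pow, ← Finset.prod_mul_distrib, ← mul_pow,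
    Finset.mul_sum, map_mul, mul_assoc]

theorem tangentSpan_scale_le (c : Fin t → ℂ) (q : (i : Fin t) × Fin (n i) → ℂ) :
    tangentSpan d (fun x => c x.1 * q x) ≤ tangentSpan d q := by
  rw [tangentSpan, Submodule.span_le]
  rintro _ ⟨⟨i, j⟩, rfl⟩
  rw [tangentVector, mono_scale, mul_smul_comm]
  exact Submodule.smul_mem _ _ (X_mul_mono_mem q i j)

theorem shearHom_zero_apply (a b : (i : Fin t) × Fin (n i) → ℂ)
    {v : MvPolynomial ((i : Fin t) × Fin (n i)) ℂ} (hv : v ∈ multiHomogeneousSubmodule t n d) :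
    shearHom a b 0 v = eval a v • mono b d := by
  rw [shearHom, aeval_def, eval₂_eq', eval_eq', Finset.sum_smul]
  refine Finset.sum_congr rfl fun μ hμ => ?_
  rw [algebraMap_eq, smul_eq_C_mul, map_mul, mul_assoc]
  congr 1
  simp only [map_zero, zero_mul, zero_add, mul_pow, Finset.prod_mul_distrib, map_prod, map_pow]
  congr 1
  rw [Fintype.prod_sigma]
  change ∏ i, ∏ j, linForm b i ^ μ ⟨i, j⟩ = ∏ i, linForm b i ^ d i
  refine Finset.prod_congr rfl fun i _ => ?_
  rw [Finset.prod_pow_eq_pow_sum, hv μ (mem_support_iff.mp hμ) i]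

theorem generic_mono_mem_tangentSum {ι : Type*} (S : Finset ι)
    {v : MvPolynomial ((i : Fin t) × Fin (n i)) ℂ} (hv : v ∈ multiHomogeneousSubmodule t n d)
    (hv0 : v ≠ 0) (h : Generic fun z : ι × ((i : Fin t) × Fin (n i)) → ℂ => v ∈ tangentSum d S z)
    (b : (i : Fin t) × Fin (n i) → ℂ) :
    Generic fun z : ι × ((i : Fin t) × Fin (n i)) → ℂ => mono b d ∈ tangentSum d S z := by
  classical
  obtain ⟨a, ha⟩ : ∃ a, eval a v ≠ 0 := by
    by_contra! h
    exact hv0 (MvPolynomial.funext fun x => by rw [h, map_zero])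
  obtain ⟨f, hf0, hf⟩ := h
  let co (s : ℂ) (z : ι × ((i : Fin t) × Fin (n i)) → ℂ) :
      ι × ((i : Fin t) × Fin (n i)) → ℂ := fun p => coshear a b s (fun x => z (p.1, x)) p.2
  have hmem : ∀ s z, v ∈ tangentSum d S (co s z) → shearHom a b s v ∈ tangentSum d S z := by
    intro s z hz
    have h1 := Submodule.mem_map_of_mem (f := (shearHom a b s).toLinearMap) hz
    rw [tangentSum, Submodule.map_iSup] at h1
    refine (iSup_mono fun e => ?_ : _ ≤ tangentSum d S z) h1
    rw [Submodule.map_iSup]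
    refine iSup_mono fun _ => (map_shearHom_tangentSpan_le a b s _).trans ?_
    change tangentSpan d (shear a b s (coshear a b s fun x => z (e, x))) ≤ _
    rw [shear_coshear]
    exact tangentSpan_scale_le (fun i => s * (s + groupPairing a b i)) _
  obtain ⟨s₀, hs₀⟩ : ∃ s : ℂ, ∀ i, s * (s + groupPairing a b i) ≠ 0 := by
    obtain ⟨s, hs⟩ := Infinite.exists_notMem_finset
      (insert (0 : ℂ) (Finset.univ.image fun i => - groupPairing a b i))
    simp only [Finset.mem_insert, Finset.mem_image, Finset.mem_univ, true_and, not_or,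
      not_exists] at hs
    refine ⟨s, fun i => mul_ne_zero hs.1 fun h => hs.2 i ?_⟩
    linear_combination -h
  let f₀ : MvPolynomial (ι × ((i : Fin t) × Fin (n i))) ℂ :=
    bind₁ (fun p => (C s₀ + C (groupPairing a b p.2.1)) * X p -
      (∑ j, C (a ⟨p.2.1, j⟩) * X (p.1, ⟨p.2.1, j⟩)) * C (b p.2)) f
  have hf₀ : ∀ z, eval z f₀ = eval (co s₀ z) f := by
    intro z
    rw [← coe_aeval_eq_eval, ← coe_aeval_eq_eval]
    simp only [f₀, RingHom.coe_coe, aeval_bind₁]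
    congr 2
    ext p
    simp [co, coshear, groupPairing]
  have hf₀' : f₀ ≠ 0 := by
    intro hzero
    refine hf0 (MvPolynomial.funext fun x => ?_)
    have := hf₀ fun p => shear a b s₀
      (fun y => (s₀ * (s₀ + groupPairing a b y.1))⁻¹ * x (p.1, y)) p.2
    rw [hzero, map_zero] at this
    rw [map_zero, this]
    congr 2
    ext p
    simp only [co]
    rw [coshear_shear]
    exact (mul_inv_cancel_left₀ (hs₀ _) _).symm
  refine ⟨f₀, hf₀', fun z hz => ?_⟩
  by_contra hnot
  obtain ⟨l, hl, hl0⟩ := Submodule.exists_dual_map_eq_bot_of_notMem hnot inferInstance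
  have hl' : ∀ w ∈ tangentSum d S z, l w = 0 := fun w hw => by
    have := Submodule.mem_map_of_mem (f := l) hw
    rwa [hl0, Submodule.mem_bot] at this
  let V : MvPolynomial Unit (MvPolynomial ((i : Fin t) × Fin (n i)) ℂ) :=
    aeval (fun x => X () * C (X x) + C (C (a x) * linForm b x.1)) v
  have hV : ∀ s : ℂ, evalPt (fun _ => s) V = shearHom a b s v := by
    intro s
    simp only [V]
    rw [map_aeval, shearHom, aeval_def, coe_eval₂Hom]
    congr 1
    · refine RingHom.ext fun c => ?_
      rw [RingHom.comp_apply, MvPolynomial.algebraMap_apply, evalPt, eval_C]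
    · ext1 x
      simp [evalPt, algebraMap_eq]
  let p : MvPolynomial Unit ℂ :=
    bind₁ (fun p => (X () + C (groupPairing a b p.2.1)) * C (z p) -
      C (groupPairing a (fun x => z (p.1, x)) p.2.1 * b p.2)) f
  have hp : ∀ s : ℂ, eval (fun _ => s) p = eval (co s z) f := by
    intro s
    rw [← coe_aeval_eq_eval, ← coe_aeval_eq_eval]
    simp only [p, RingHom.coe_coe, aeval_bind₁]
    congr 2
    ext y
    simp [co, coshear]
  have hprod : coeffMap l V * p = 0 := MvPolynomial.funext fun s => by
    have hs : s = fun _ => s () := rfl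
    rw [hs, map_mul, map_zero, eval_coeffMap, hV, hp, mul_eq_zero, or_iff_not_imp_right]
    exact fun h => hl' _ (hmem _ _ (hf _ h))
  rcases mul_eq_zero.mp hprod with h | h
  · have := congrArg (eval fun _ => 0) h
    rw [eval_coeffMap, hV, shearHom_zero_apply a b hv, map_smul, map_zero, smul_eq_mul] at this
    exact mul_ne_zero ha hl this
  · apply hz
    rw [hf₀, ← hp, h, map_zero]

theorem tangentRank_eq_of_generic_mem {ι : Type*} (hd : ∀ i, 1 ≤ d i) (S : Finset ι)
    {v : MvPolynomial ((i : Fin t) × Fin (n i)) ℂ} (hv : v ∈ multiHomogeneousSubmodule t n d)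
    (hv0 : v ≠ 0)
    (h : Generic fun z : ι × ((i : Fin t) × Fin (n i)) → ℂ => v ∈ tangentSum d S z) :
    tangentRank n d S.card = Module.finrank ℂ (multiHomogeneousSubmodule t n d) := by
  have hfg : (Submodule.span ℂ (Set.range fun q => mono (n := n) q d)).FG := by
    rw [span_range_mono, ← Submodule.fg_top]
    exact Module.Finite.fg_top
  obtain ⟨F, hF, hspan⟩ := (Submodule.fg_span_iff_fg_span_finset_subset _).mp hfg
  rw [span_range_mono] at hspan
  have hgen := Generic.finite_forall fun w : F => show Generic fun z => w.1 ∈ tangentSum d S z by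
    obtain ⟨b, hb⟩ := hF w.2
    have := generic_mono_mem_tangentSum S hv hv0 h b
    rwa [← hb]
  obtain ⟨z, hz⟩ := hgen.exists_point
  refine le_antisymm (tangentRank_le hd _) (le_trans ?_ (finrank_tangentSum_le_tangentRank hd S z))
  have := finiteDimensional_of_le (tangentSum_le hd S z)
  refine Submodule.finrank_mono ?_
  rw [hspan, Submodule.span_le]
  exact fun w hw => hz ⟨w, hw⟩

end Degeneration

section Concavity

variable {t : ℕ} {n : Fin t → ℕ} {d : Fin t → ℕ}

theorem tangentSum_union {ι : Type*} [DecidableEq ι] (S S' : Finset ι)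
    (z : ι × ((i : Fin t) × Fin (n i)) → ℂ) :
    tangentSum d (S ∪ S') z = tangentSum d S z ⊔ tangentSum d S' z :=
  Finset.iSup_union

theorem tangentSum_congr {ι : Type*} {S : Finset ι}
    {z z' : ι × ((i : Fin t) × Fin (n i)) → ℂ} (h : ∀ e ∈ S, ∀ s, z (e, s) = z' (e, s)) :
    tangentSum d S z = tangentSum d S z' := by
  refine iSup_congr fun e => iSup_congr fun he => ?_
  simp only [h e he]

theorem finrank_tangentSum_union_add_inf {ι : Type*} [DecidableEq ι] (hd : ∀ i, 1 ≤ d i)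
    (S S' : Finset ι) (z : ι × ((i : Fin t) × Fin (n i)) → ℂ) :
    Module.finrank ℂ (tangentSum d (S ∪ S') z) +
      Module.finrank ℂ (tangentSum d S z ⊓ tangentSum d S' z : Submodule ℂ _) =
    Module.finrank ℂ (tangentSum d S z) + Module.finrank ℂ (tangentSum d S' z) := by
  have := finiteDimensional_of_le (tangentSum_le hd S z)
  have := finiteDimensional_of_le (tangentSum_le hd S' z)
  rw [tangentSum_union, Submodule.finrank_sup_add_finrank_inf_eq]

theorem generic_forall_finrank_tangentSum {ι : Type*} [Finite ι] (hd : ∀ i, 1 ≤ d i) :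
    Generic fun z : ι × ((i : Fin t) × Fin (n i)) → ℂ => ∀ S : Finset ι,
      Module.finrank ℂ (tangentSum d S z) = tangentRank n d S.card :=
  Generic.finite_forall fun S => generic_finrank_tangentSum hd S

theorem tangentRank_mono (hd : ∀ i, 1 ≤ d i) : Monotone (tangentRank n d) := by
  refine monotone_nat_of_le_succ fun k => ?_
  obtain ⟨z, hz⟩ := (generic_forall_finrank_tangentSum (ι := Fin (k + 1)) (n := n) hd).exists_point
  have h1 := hz Finset.univ
  have h2 := hz (Finset.univ.erase (Fin.last k))
  rw [Finset.card_erase_of_mem (Finset.mem_univ _)] at h2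
  simp only [Finset.card_univ, Fintype.card_fin, Nat.add_sub_cancel] at h1 h2
  rw [← h1, ← h2]
  have := finiteDimensional_of_le (tangentSum_le hd Finset.univ z)
  exact Submodule.finrank_mono (tangentSum_mono (Finset.subset_univ _) z)

theorem tangentRank_concave (hd : ∀ i, 1 ≤ d i) (k : ℕ) :
    tangentRank n d (k + 2) + tangentRank n d k ≤ 2 * tangentRank n d (k + 1) := by
  classical
  obtain ⟨z, hz⟩ :=
    (generic_forall_finrank_tangentSum (ι := Fin k ⊕ Bool) (n := n) hd).exists_point
  let S : Finset (Fin k ⊕ Bool) := Finset.univ.map Function.Embedding.inl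
  have hS : S.card = k := by simp [S]
  have hb : ∀ b, Sum.inr b ∉ S := by simp [S]
  have h := finrank_tangentSum_union_add_inf hd (insert (.inr true) S) (insert (.inr false) S) z
  have hU : (insert (.inr true) S ∪ insert (.inr false) S).card = k + 2 := by
    rw [Finset.insert_union, Finset.union_insert, Finset.union_self,
      Finset.card_insert_of_notMem (by simp [S]), Finset.card_insert_of_notMem (hb _), hS]
  rw [hz, hz, hz, hU, Finset.card_insert_of_notMem (hb _), Finset.card_insert_of_notMem (hb _),
    hS] at h
  have := finiteDimensional_of_le (tangentSum_le hd (insert (.inr true) S) z)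
  have h2 := Submodule.finrank_mono (le_inf
    (tangentSum_mono (d := d) (Finset.subset_insert (.inr true) S) z)
    (tangentSum_mono (d := d) (Finset.subset_insert (.inr false) S) z))
  rw [hz, hS] at h2
  omega

/-- At a configuration of maximal ranks, once the increments of the rank stabilise, the
intersection of a tangent space with the sum of `k` others does not depend on these. -/
theorem inf_tangentSum_eq {ι : Type*} [DecidableEq ι] (hd : ∀ i, 1 ≤ d i) {k : ℕ}
    (h : tangentRank n d (k + 2) + tangentRank n d k = 2 * tangentRank n d (k + 1))
    {z : ι × ((i : Fin t) × Fin (n i)) → ℂ}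
    (hz : ∀ S : Finset ι, Module.finrank ℂ (tangentSum d S z) = tangentRank n d S.card)
    (x : ι) (m : ℕ) (S S' : Finset ι) (hm : (S' \ S).card = m) (hS : S.card = k)
    (hS' : S'.card = k) (hx : x ∉ S) (hx' : x ∉ S') :
    tangentSum d {x} z ⊓ tangentSum d S z = tangentSum d {x} z ⊓ tangentSum d S' z := by
  have hfd := finiteDimensional_of_le (tangentSum_le hd {x} z)
  have hins : ∀ (S : Finset ι) (a : ι), S.card = k → a ∉ S → x ∉ S → x ≠ a →
      tangentSum d {x} z ⊓ tangentSum d S z =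
        tangentSum d {x} z ⊓ tangentSum d (insert a S) z := by
    intro S a hS ha hx hxa
    have hxa' : x ∉ insert a S := by simp [hx, hxa]
    refine Submodule.eq_of_le_of_finrank_eq
      (inf_le_inf_left _ (tangentSum_mono (Finset.subset_insert a S) z)) ?_
    have h1 := finrank_tangentSum_union_add_inf hd {x} S z
    have h2 := finrank_tangentSum_union_add_inf hd {x} (insert a S) z
    rw [← Finset.insert_eq, hz, hz, hz, Finset.card_insert_of_notMem hx, hS] at h1
    rw [← Finset.insert_eq, hz, hz, hz, Finset.card_insert_of_notMem hxa',
      Finset.card_insert_of_notMem ha, hS, show k + 1 + 1 = k + 2 from rfl] at h2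
    omega
  induction m generalizing S with
  | zero =>
    rw [Finset.card_eq_zero, Finset.sdiff_eq_empty_iff_subset] at hm
    rw [Finset.eq_of_subset_of_card_le hm (by omega)]
  | succ m ih =>
    obtain ⟨a, ha⟩ := Finset.card_pos.mp (show 0 < (S' \ S).card by omega)
    rw [Finset.mem_sdiff] at ha
    obtain ⟨b, hb⟩ : (S \ S').Nonempty := by
      rw [← Finset.card_pos, Finset.card_sdiff_comm (hS.trans hS'.symm)]
      omega
    rw [Finset.mem_sdiff] at hb
    have hxa : x ≠ a := fun h => hx' (h ▸ ha.1)
    have hxb : x ≠ b := fun h => hx (h ▸ hb.1)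
    have hab : a ≠ b := fun h => hb.2 (h ▸ ha.1)
    have hcard : (insert a (S.erase b)).card = k := by
      rw [Finset.card_insert_of_notMem (by simp [ha.2]), Finset.card_erase_of_mem hb.1, hS]
      have := Finset.card_pos.mpr ⟨b, hb.1⟩
      omega
    have h2 := hins (insert a (S.erase b)) b hcard (by simp [hab.symm]) (by simp [hxa, hx]) hxb
    rw [Finset.insert_comm, Finset.insert_erase hb.1] at h2
    rw [hins S a hS ha.2 hx hxa, ← h2]
    refine ih _ ?_ hcard (by simp [hxa, hx])
    have : S' \ insert a (S.erase b) = (S' \ S).erase a := by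
      ext y
      simp only [Finset.mem_sdiff, Finset.mem_insert, Finset.mem_erase]
      constructor
      · rintro ⟨h1, h2⟩
        push Not at h2
        exact ⟨h2.1, h1, fun hy => h2.2 (fun h => hb.2 (h ▸ h1)) hy⟩
      · rintro ⟨h1, h2, h3⟩
        exact ⟨h2, by rintro (h | h); exacts [h1 h, h3 h.2]⟩
    rw [this, Finset.card_erase_of_mem (by simpa using ha), hm, Nat.add_sub_cancel]

theorem tangentRank_eq_finrank_of_concave_eq (hd : ∀ i, 1 ≤ d i) {k : ℕ}
    (h : tangentRank n d (k + 2) + tangentRank n d k = 2 * tangentRank n d (k + 1))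
    (hlt : tangentRank n d (k + 1) < tangentRank n d k + tangentRank n d 1) :
    tangentRank n d k = Module.finrank ℂ (multiHomogeneousSubmodule t n d) := by
  classical
  obtain ⟨f, hf0, hf⟩ := generic_forall_finrank_tangentSum
    (ι := Fin k ⊕ (Fin k ⊕ Unit)) (n := n) hd
  let S : Finset (Fin k ⊕ (Fin k ⊕ Unit)) := Finset.univ.map Function.Embedding.inl
  let S' : Finset (Fin k ⊕ (Fin k ⊕ Unit)) :=
    Finset.univ.map (Function.Embedding.inl.trans Function.Embedding.inr)
  let x : Fin k ⊕ (Fin k ⊕ Unit) := .inr (.inr ())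
  have hS : S.card = k := by simp [S]
  have hS' : S'.card = k := by simp [S']
  have hx : x ∉ S := by simp [S, x]
  have hx' : x ∉ S' := by simp [S', x]
  obtain ⟨z₀, hz₀⟩ : ∃ z, eval z f ≠ 0 := by
    by_contra! h
    exact hf0 (MvPolynomial.funext fun x => by rw [h, map_zero])
  obtain ⟨v, hv, hv0⟩ : ∃ v ∈ tangentSum d {x} z₀ ⊓ tangentSum d S' z₀, v ≠ 0 := by
    by_contra! hcon
    have h1 := finrank_tangentSum_union_add_inf hd {x} S' z₀
    rw [(Submodule.eq_bot_iff _).mpr hcon, finrank_bot, ← Finset.insert_eq, hf z₀ hz₀,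
      hf z₀ hz₀, hf z₀ hz₀, Finset.card_insert_of_notMem hx', hS', Finset.card_singleton] at h1
    omega
  let ext (p : Fin k × ((i : Fin t) × Fin (n i)) → ℂ) :
      (Fin k ⊕ (Fin k ⊕ Unit)) × ((i : Fin t) × Fin (n i)) → ℂ := fun y =>
    Sum.elim (fun e => p (e, y.2)) (fun e => z₀ (.inr e, y.2)) y.1
  let g : MvPolynomial (Fin k × ((i : Fin t) × Fin (n i))) ℂ :=
    bind₁ (fun y => Sum.elim (fun e => X (e, y.2)) (fun e => C (z₀ (.inr e, y.2))) y.1) f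
  have hg : ∀ p, eval p g = eval (ext p) f := by
    intro p
    rw [← coe_aeval_eq_eval, ← coe_aeval_eq_eval]
    simp only [g, RingHom.coe_coe, aeval_bind₁]
    congr 2
    ext ⟨e | e, s⟩ <;> simp [ext]
  have hext : ∀ T : Finset (Fin k ⊕ (Fin k ⊕ Unit)), (∀ e ∈ T, ∃ e', e = .inr e') →
      ∀ p, tangentSum d T (ext p) = tangentSum d T z₀ := by
    intro T hT p
    refine tangentSum_congr fun e he s => ?_
    obtain ⟨e', rfl⟩ := hT e he
    rfl
  have hgen : Generic fun p : Fin k × ((i : Fin t) × Fin (n i)) → ℂ =>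
      v ∈ tangentSum d Finset.univ p := by
    refine Generic.mono (Generic.of_eval_ne_zero (f := g) (x := fun y => z₀ (.inl y.1, y.2)) ?_)
      fun p hp => ?_
    · rw [hg]
      convert hz₀ using 3
      ext ⟨e | e, s⟩ <;> rfl
    · rw [hg] at hp
      have heq := inf_tangentSum_eq hd h (hf _ hp) x _ S S' rfl hS hS' hx hx'
      rw [hext S' (by simp [S']), hext {x} (by simp [x])] at heq
      rw [← heq] at hv
      refine (iSup₂_le fun e he => ?_ : tangentSum d S (ext p) ≤ _) hv.2
      obtain ⟨e', -, rfl⟩ := Finset.mem_map.mp he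
      exact le_iSup₂_of_le e' (Finset.mem_univ _) le_rfl
  have := tangentRank_eq_of_generic_mem hd Finset.univ (tangentSum_le hd _ _ hv.2) hv0 hgen
  rwa [Finset.card_univ, Fintype.card_fin] at this

end Concavity

section ConcaveSequences

variable {r : ℕ → ℕ} {N D : ℕ}

theorem concave_increment_le (h0 : r 0 = 0) (h1 : r 1 = N)
    (hc : ∀ k, r (k + 2) + r k ≤ 2 * r (k + 1)) (k : ℕ) : r (k + 1) ≤ r k + N := by
  induction k with
  | zero => rw [zero_add, h1]; omega
  | succ k ih =>
    have h2 := hc k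
    have h3 : r (k + 1 + 1) = r (k + 2) := rfl
    omega

theorem concave_linear_or_drop (h0 : r 0 = 0) (h1 : r 1 = N)
    (hc : ∀ k, r (k + 2) + r k ≤ 2 * r (k + 1)) (k : ℕ) :
    r k = k * N ∨ ∃ k₀ < k, r k₀ = k₀ * N ∧ r (k₀ + 1) < r k₀ + N := by
  induction k with
  | zero => left; omega
  | succ k ih =>
    rcases ih with ih | ⟨k₀, hk₀, h⟩
    · rcases (concave_increment_le h0 h1 hc k).lt_or_eq with h | h
      · exact Or.inr ⟨k, k.lt_succ_self, ih, h⟩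
      · left
        rw [h, ih]
        ring
    · exact Or.inr ⟨k₀, by omega, h⟩

theorem concave_increment_le_of_drop (hmono : Monotone r) (hD : ∀ k, r k ≤ D)
    (hc : ∀ k, r (k + 2) + r k ≤ 2 * r (k + 1))
    (hs : ∀ k, r (k + 2) + r k = 2 * r (k + 1) → r (k + 1) < r k + N → r k = D)
    {k₀ : ℕ} (hk₀ : r (k₀ + 1) < r k₀ + N) (j : ℕ) :
    r (k₀ + j + 1) ≤ r (k₀ + j) + (N - 1 - j) := by
  induction j with
  | zero =>
    rw [add_zero]
    omega
  | succ j ih =>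
    have h2 := hc (k₀ + j)
    have h3 := hD (k₀ + j + 2)
    have h4 := hmono (show k₀ + j ≤ k₀ + j + 1 by omega)
    have h5 := hs (k₀ + j)
    have h6 := hmono (show k₀ + j + 1 ≤ k₀ + j + 2 by omega)
    rw [show k₀ + (j + 1) + 1 = k₀ + j + 2 by ring, show k₀ + (j + 1) = k₀ + j + 1 by ring]
    omega

theorem concave_eq_of_drop (hmono : Monotone r) (hD : ∀ k, r k ≤ D)
    (hc : ∀ k, r (k + 2) + r k ≤ 2 * r (k + 1))
    (hs : ∀ k, r (k + 2) + r k = 2 * r (k + 1) → r (k + 1) < r k + N → r k = D)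
    {k₀ : ℕ} (hk₀ : r (k₀ + 1) < r k₀ + N) (hN : 1 ≤ N) : r (k₀ + (N - 1)) = D := by
  have h1 := concave_increment_le_of_drop hmono hD hc hs hk₀ (N - 1)
  have h2 := hc (k₀ + (N - 1))
  have h3 := hmono (show k₀ + (N - 1) ≤ k₀ + (N - 1) + 1 by omega)
  have h4 := hmono (show k₀ + (N - 1) + 1 ≤ k₀ + (N - 1) + 2 by omega)
  exact hs _ (by omega) (by omega)

theorem concave_eq_linear (h0 : r 0 = 0) (h1 : r 1 = N) (hmono : Monotone r) (hD : ∀ k, r k ≤ D)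
    (hc : ∀ k, r (k + 2) + r k ≤ 2 * r (k + 1))
    (hs : ∀ k, r (k + 2) + r k = 2 * r (k + 1) → r (k + 1) < r k + N → r k = D)
    (hN : 1 ≤ N) {m : ℕ} (hm : N * (m + N) ≤ D) : r m = m * N := by
  rcases concave_linear_or_drop h0 h1 hc m with h | ⟨k₀, hlt, hk₀, hdrop⟩
  · exact h
  · exfalso
    have hlin : ∀ j, r (k₀ + j) ≤ k₀ * N + j * N := by
      intro j
      induction j with
      | zero => rw [add_zero, hk₀]; omega
      | succ j ih =>
        have := concave_increment_le h0 h1 hc (k₀ + j)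
        rw [← add_assoc]
        linarith
    have h2 := concave_eq_of_drop hmono hD hc hs hdrop hN
    have h3 := hlin (N - 1)
    have h4 : k₀ * N + (N - 1) * N < N * (m + N) := by
      obtain ⟨M, rfl⟩ : ∃ M, N = M + 1 := ⟨N - 1, by omega⟩
      rw [Nat.add_sub_cancel]
      nlinarith
    omega

theorem concave_eq_top (h0 : r 0 = 0) (h1 : r 1 = N) (hmono : Monotone r) (hD : ∀ k, r k ≤ D)
    (hc : ∀ k, r (k + 2) + r k ≤ 2 * r (k + 1))
    (hs : ∀ k, r (k + 2) + r k = 2 * r (k + 1) → r (k + 1) < r k + N → r k = D)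
    (hN : 1 ≤ N) {m : ℕ} (hm : D + N ^ 2 ≤ m * N) : r m = D := by
  rcases concave_linear_or_drop h0 h1 hc m with h | ⟨k₀, hlt, hk₀, hdrop⟩
  · have := hD m
    nlinarith
  · have h2 := concave_eq_of_drop hmono hD hc hs hdrop hN
    have h3 := hD k₀
    have h4 : k₀ + N ≤ m := by
      by_contra! h
      nlinarith
    have h5 := hmono (show k₀ + (N - 1) ≤ m by omega)
    exact le_antisymm (hD m) (h2 ▸ h5)

end ConcaveSequences

section Parametrization

variable {t : ℕ} {n : Fin t → ℕ} {d : Fin t → ℕ}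

/-- The generic sum of `m` points of the cone over the Segre–Veronese variety. -/
def genericSum (n d : Fin t → ℕ) (m : ℕ) : MvPolynomial (Fin m × ((i : Fin t) × Fin (n i)))
    (MvPolynomial ((i : Fin t) × Fin (n i)) ℂ) :=
  ∑ e, segre (fun s => X (e, s)) (fun s => C (X s)) d

theorem evalPt_genericSum {m : ℕ} (z : Fin m × ((i : Fin t) × Fin (n i)) → ℂ) :
    evalPt z (genericSum n d m) = ∑ e, mono (fun s => z (e, s)) d := by
  rw [genericSum, map_sum]
  refine Finset.sum_congr rfl fun e _ => ?_
  rw [evalPt, map_segre, mono]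
  simp [algebraMap_eq]

theorem Derivation.map_prod_eq_zero {R A ι : Type*} [CommRing R] [CommRing A] [Algebra R A]
    (δ : Derivation R A A) (S : Finset ι) (f : ι → A) (h : ∀ i ∈ S, δ (f i) = 0) :
    δ (∏ i ∈ S, f i) = 0 := by
  classical
  induction S using Finset.induction_on with
  | empty => simp
  | insert a S ha ih =>
    rw [Finset.prod_insert ha, Derivation.leibniz, h a (Finset.mem_insert_self a S),
      ih fun i hi => h i (Finset.mem_insert_of_mem hi), smul_zero, smul_zero, add_zero]

theorem evalPt_pderiv_genericSum {m : ℕ} (z : Fin m × ((i : Fin t) × Fin (n i)) → ℂ) (e : Fin m)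
    (s : (i : Fin t) × Fin (n i)) :
    evalPt z (pderiv (e, s) (genericSum n d m)) =
      (d s.1 : ℂ) • tangentVector d (fun s => z (e, s)) s := by
  classical
  obtain ⟨i, j⟩ := s
  have hL : ∀ e' i', pderiv (e, (⟨i, j⟩ : (i : Fin t) × Fin (n i)))
      (∑ j', X (e', (⟨i', j'⟩ : (i : Fin t) × Fin (n i))) * C (X ⟨i', j'⟩) : MvPolynomial
        (Fin m × ((i : Fin t) × Fin (n i))) (MvPolynomial ((i : Fin t) × Fin (n i)) ℂ)) =
      if e' = e ∧ i' = i then C (X ⟨i, j⟩) else 0 := by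
    intro e' i'
    simp only [map_sum, Derivation.leibniz, pderiv_C, zero_add, pderiv_X,
      Pi.single_apply, Prod.mk.injEq, smul_eq_mul, mul_ite, mul_one, mul_zero]
    split_ifs with h
    · obtain ⟨rfl, rfl⟩ := h
      simp
    · refine Finset.sum_eq_zero fun k _ => if_neg ?_
      rintro ⟨rfl, h'⟩
      exact h ⟨rfl, congrArg Sigma.fst h'⟩
  rw [genericSum, map_sum, Finset.sum_eq_single e]
  · rw [segre, ← Finset.mul_prod_erase _ _ (Finset.mem_univ i), Derivation.leibniz,
      Derivation.map_prod_eq_zero _ (Finset.univ.erase i) _ fun i' hi' => by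
        rw [Derivation.leibniz_pow, hL, if_neg fun h => Finset.ne_of_mem_erase hi' h.2]
        simp,
      Derivation.leibniz_pow, hL, if_pos ⟨rfl, rfl⟩, smul_zero, zero_add, tangentVector, mono,
      segre, ← Finset.mul_prod_erase _ _ (Finset.mem_univ i)]
    have h2 : ∀ i' ∈ Finset.univ.erase i, (∑ k, C (z (e, ⟨i', k⟩)) * X ⟨i', k⟩ :
        MvPolynomial ((i : Fin t) × Fin (n i)) ℂ) ^ (d - Pi.single i 1 : Fin t → ℕ) i' =
        (∑ k, C (z (e, ⟨i', k⟩)) * X ⟨i', k⟩) ^ d i' := by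
      intro i' hi'
      simp [Finset.ne_of_mem_erase hi']
    rw [Finset.prod_congr rfl h2]
    simp [evalPt, algebraMap_eq, smul_eq_C_mul]
    ring
  · intro e' _ he'
    exact Derivation.map_prod_eq_zero _ _ _ fun i' _ => by
      rw [Derivation.leibniz_pow, hL, if_neg fun h => he' h.1]
      simp
  · simp

/-- Functionals that are independent on a sum of tangent spaces define algebraically independent
functions of the parameters. -/
theorem algebraicIndependent_coeffMap_genericSum (hd : ∀ i, 1 ≤ d i) {m : ℕ} {κ : Type*}
    [Fintype κ] (l : κ → MvPolynomial ((i : Fin t) × Fin (n i)) ℂ →ₗ[ℂ] ℂ)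
    (z : Fin m × ((i : Fin t) × Fin (n i)) → ℂ)
    (hl : ∀ c : κ → ℂ, (∀ w ∈ tangentSum d Finset.univ z, ∑ k, c k * l k w = 0) → c = 0) :
    AlgebraicIndependent ℂ fun k => coeffMap (l k) (genericSum n d m) := by
  classical
  refine algebraicIndependent_of_gradient _ z ?_
  rw [Fintype.linearIndependent_iff]
  intro c hc
  refine congrFun (hl c fun w hw => ?_)
  have hle : tangentSum d Finset.univ z ≤ LinearMap.ker (∑ k, c k • l k) := by
    refine iSup₂_le fun e _ => ?_
    rw [tangentSpan, Submodule.span_le]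
    rintro _ ⟨s, rfl⟩
    have h1 := congrFun hc (e, s)
    simp only [Finset.sum_apply, Pi.smul_apply, pderiv_coeffMap, eval_coeffMap,
      evalPt_pderiv_genericSum, map_smul, smul_eq_mul, Pi.zero_apply] at h1
    have h2 : (d s.1 : ℂ) ≠ 0 := by
      have := hd s.1
      exact_mod_cast (by omega : d s.1 ≠ 0)
    simp only [SetLike.mem_coe, LinearMap.mem_ker, LinearMap.sum_apply, LinearMap.smul_apply,
      smul_eq_mul]
    refine (mul_eq_zero.mp ?_).resolve_left h2
    rw [← h1, Finset.mul_sum]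
    exact Finset.sum_congr rfl fun k _ => by ring
  simpa using hle hw

theorem mono_scale_eq (c : Fin t → ℂ) (hc : ∏ i, c i ^ d i = 1)
    (q : (i : Fin t) × Fin (n i) → ℂ) : mono (fun x => c x.1 * q x) d = mono q d := by
  rw [mono_scale, hc, one_smul]

/-- A multi-projective point can be rescaled to lie on the standard chart. -/
theorem exists_chart_scaling (hd : ∀ i, 1 ≤ d i) (i₀ : Fin t) (u : Fin t → ℂ)
    (hu : ∀ i, u i ≠ 0) : ∃ c : Fin t → ℂ, ∏ i, c i ^ d i = 1 ∧ ∀ i ≠ i₀, c i * u i = 1 := by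
  classical
  obtain ⟨a, ha⟩ := IsAlgClosed.exists_pow_nat_eq (∏ i ∈ Finset.univ.erase i₀, u i ^ d i) (hd i₀)
  refine ⟨fun i => if i = i₀ then a else (u i)⁻¹, ?_, fun i hi => ?_⟩
  · rw [← Finset.mul_prod_erase _ _ (Finset.mem_univ i₀)]
    beta_reduce
    rw [if_pos rfl, ha, ← Finset.prod_mul_distrib]
    refine Finset.prod_eq_one fun i hi => ?_
    rw [if_neg (Finset.ne_of_mem_erase hi), ← mul_pow, mul_inv_cancel₀ (hu i), one_pow]
  · simp [hi, hu i]

end Parametrization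

/-- A polynomial that vanishes on sums of points of `S` vanishes on sums of points of the
closure of `S`. -/
theorem eval_sum_eq_zero_of_mem_zClosureV {M B : Type*} [AddCommGroup M] [Module ℂ M] [Fintype B]
    (b : Module.Basis B ℂ M) {m : ℕ} (S : Set M) (p : MvPolynomial B ℂ)
    (h : ∀ x : Fin m → M, (∀ i, x i ∈ S) → eval (b.equivFun (∑ i, x i)) p = 0)
    (x : Fin m → M) (hx : ∀ i, x i ∈ zClosureV S) : eval (b.equivFun (∑ i, x i)) p = 0 := by
  classical
  suffices H : ∀ (T : Finset (Fin m)) (x : Fin m → M), (∀ i ∈ T, x i ∈ zClosureV S) →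
      (∀ i ∉ T, x i ∈ S) → eval (b.equivFun (∑ i, x i)) p = 0 from
    H Finset.univ x (fun i _ => hx i) fun i hi => absurd (Finset.mem_univ i) hi
  intro T
  induction T using Finset.induction_on with
  | empty => exact fun x _ hx => h x fun i => hx i (Finset.notMem_empty i)
  | insert a T ha ih =>
    intro x hT hS
    let c := ∑ i ∈ Finset.univ.erase a, x i
    let p' : MvPolynomial B ℂ := bind₁ (fun β => X β + C (b.equivFun c β)) p
    have hp' : ∀ y, eval (b.equivFun y) p' = eval (b.equivFun (y + c)) p := by
      intro y
      rw [← coe_aeval_eq_eval, ← coe_aeval_eq_eval]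
      simp only [p', RingHom.coe_coe, aeval_bind₁]
      congr 2
      ext β
      simp
    rw [← Finset.add_sum_erase _ _ (Finset.mem_univ a), ← hp']
    refine (mem_zClosureV_iff b S (x a)).mp (hT a (Finset.mem_insert_self a T)) p' fun y hy => ?_
    have hsum : ∑ i, Function.update x a y i = y + c := by
      rw [← Finset.add_sum_erase _ _ (Finset.mem_univ a), Function.update_self]
      exact congrArg (y + ·) (Finset.sum_congr rfl fun i hi =>
        Function.update_of_ne (Finset.ne_of_mem_erase hi) _ _)
    rw [hp', ← hsum]
    refine ih _ (fun i hi => ?_) fun i hi => ?_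
    · rw [Function.update_of_ne (ne_of_mem_of_not_mem hi ha)]
      exact hT i (Finset.mem_insert_of_mem hi)
    · by_cases hia : i = a
      · rw [hia, Function.update_self]
        exact hy
      · rw [Function.update_of_ne hia]
        exact hS i fun hi' => (Finset.mem_insert.mp hi').elim hia hi

section Secant

variable {t : ℕ} {n : Fin t → ℕ} {d : Fin t → ℕ} {m : ℕ}

/-- The sum of the points of the cone over the Segre–Veronese variety with parameters `z`. -/
def secantPoint (d : Fin t → ℕ) (z : Fin m × ((i : Fin t) × Fin (n i)) → ℂ) :
    multiHomogeneousSubmodule t n d :=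
  ∑ e, ⟨mono (fun s => z (e, s)) d, mono_mem _ d⟩

theorem coe_secantPoint (z : Fin m × ((i : Fin t) × Fin (n i)) → ℂ) :
    (secantPoint d z : MvPolynomial ((i : Fin t) × Fin (n i)) ℂ) = evalPt z (genericSum n d m) := by
  rw [evalPt_genericSum, secantPoint, Submodule.coe_sum]

/-- The coordinate functionals of a basis, extended to all polynomials. -/
def extCoord {B : Type*} (b : Module.Basis B ℂ (multiHomogeneousSubmodule t n d)) (β : B) :
    MvPolynomial ((i : Fin t) × Fin (n i)) ℂ →ₗ[ℂ] ℂ :=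
  (LinearMap.exists_extend (b.coord β)).choose

theorem extCoord_apply {B : Type*} (b : Module.Basis B ℂ (multiHomogeneousSubmodule t n d)) (β : B)
    (f : multiHomogeneousSubmodule t n d) : extCoord b β f = b.coord β f :=
  LinearMap.congr_fun (LinearMap.exists_extend (b.coord β)).choose_spec f

/-- The pullback of polynomial functions along the parametrization of sums of `m` points. -/
def secantHom {B : Type*} (b : Module.Basis B ℂ (multiHomogeneousSubmodule t n d)) (m : ℕ) :
    MvPolynomial B ℂ →ₐ[ℂ] MvPolynomial (Fin m × ((i : Fin t) × Fin (n i))) ℂ :=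
  aeval fun β => coeffMap (extCoord b β) (genericSum n d m)

variable {B : Type} [Fintype B] (b : Module.Basis B ℂ (multiHomogeneousSubmodule t n d))

theorem eval_secantHom (z : Fin m × ((i : Fin t) × Fin (n i)) → ℂ) (p : MvPolynomial B ℂ) :
    eval z (secantHom b m p) = eval (b.equivFun (secantPoint d z)) p := by
  have h : (aeval z).comp (secantHom b m) = aeval (b.equivFun (secantPoint d z)) := by
    ext β
    simp only [secantHom, AlgHom.comp_apply, aeval_X]
    rw [aeval_eq_eval, eval_coeffMap, ← coe_secantPoint, extCoord_apply]
    simp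
  exact DFunLike.congr_fun h p

theorem mem_ker_secantHom_iff (p : MvPolynomial B ℂ) :
    p ∈ RingHom.ker (secantHom b m) ↔
      ∀ z, eval (b.equivFun (secantPoint (m := m) d z)) p = 0 := by
  simp_rw [RingHom.mem_ker, ← eval_secantHom]
  exact ⟨fun h z => by rw [h, map_zero], fun h => MvPolynomial.funext fun z => by rw [h, map_zero]⟩

theorem segreVeronese_eq_zClosureV_range :
    SegreVeronese t n d = zClosureV (Set.range fun q : (i : Fin t) × Fin (n i) → ℂ =>
      (⟨mono q d, mono_mem q d⟩ : multiHomogeneousSubmodule t n d)) := by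
  rw [SegreVeronese]
  congr 1
  ext f
  constructor
  · rintro ⟨ℓ, hℓ⟩
    refine ⟨fun s => ℓ s.1 s.2, Subtype.ext ?_⟩
    simp only [hℓ, mono, segre, smul_eq_C_mul]
  · rintro ⟨q, rfl⟩
    exact ⟨fun i j => q ⟨i, j⟩, by simp only [mono, segre, smul_eq_C_mul]⟩

theorem mem_secantV_segreVeronese_iff (x : multiHomogeneousSubmodule t n d) :
    x ∈ secantV m (SegreVeronese t n d) ↔
      ∀ p ∈ RingHom.ker (secantHom b m), eval (b.equivFun x) p = 0 := by
  rw [secantV, mem_zClosureV_iff b]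
  refine forall_congr' fun p => imp_congr_left ?_
  rw [mem_ker_secantHom_iff, segreVeronese_eq_zClosureV_range]
  constructor
  · exact fun h z => h _ ⟨_, fun i => @subset_closure _ (ztV _) _ _ ⟨fun s => z (i, s), rfl⟩, rfl⟩
  · rintro h _ ⟨y, hy, rfl⟩
    refine eval_sum_eq_zero_of_mem_zClosureV b _ p (fun y hy => ?_) y hy
    choose q hq using hy
    have := h fun s => q s.1 s.2
    simp only [secantPoint, hq] at this
    exact this

theorem secantV_one_segreVeronese : secantV 1 (SegreVeronese t n d) = SegreVeronese t n d := by
  have : { p | ∃ x : Fin 1 → multiHomogeneousSubmodule t n d,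
      (∀ i, x i ∈ SegreVeronese t n d) ∧ p = ∑ i, x i } = SegreVeronese t n d := by
    ext p
    constructor
    · rintro ⟨x, hx, rfl⟩
      simpa using hx 0
    · exact fun hp => ⟨fun _ => p, fun _ => hp, by simp⟩
  rw [secantV, this, SegreVeronese, zClosureV, zClosureV, @closure_closure _ (ztV _)]

theorem zDimV_secantV_segreVeronese {s : ℕ}
    (hs : Algebra.trdeg ℂ (MvPolynomial B ℂ ⧸ RingHom.ker (secantHom b m)) = s) :
    zDimV (secantV m (SegreVeronese t n d)) = s := by
  have := RingHom.ker_isPrime (secantHom b m)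
  rw [zDimV_eq_ringKrullDim_quotient b _ _ (mem_secantV_segreVeronese_iff b)]
  exact ringKrullDim_eq_trdeg hs

theorem tangentRank_le_trdeg (hd : ∀ i, 1 ≤ d i) :
    (tangentRank n d m : Cardinal) ≤
      Algebra.trdeg ℂ (MvPolynomial B ℂ ⧸ RingHom.ker (secantHom b m)) := by
  classical
  obtain ⟨z, hz⟩ := exists_finrank_tangentSum_eq (n := n) hd m
  have := finiteDimensional_of_le (tangentSum_le hd Finset.univ z)
  let v := Module.finBasis ℂ (tangentSum d Finset.univ z)
  obtain ⟨l, hl⟩ := LinearIndependent.exists_dual_family (v.linearIndependent.map' _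
    (Submodule.ker_subtype _))
  have hF := algebraicIndependent_coeffMap_genericSum hd l z fun c hc => by
    ext k
    have := hc _ (v k).2
    have h' : ∀ k', l k' (v k : MvPolynomial ((i : Fin t) × Fin (n i)) ℂ) =
      if k' = k then 1 else 0 := fun k' => hl k' k
    simpa [h'] using this
  let g k : MvPolynomial B ℂ := ∑ β, C (l k (b β)) * X β
  have hg : ∀ k, secantHom b m (g k) = coeffMap (l k) (genericSum n d m) := by
    intro k
    refine MvPolynomial.funext fun z => ?_
    rw [eval_secantHom, eval_coeffMap, ← coe_secantPoint]
    have h := congrArg (l k ∘ₗ Submodule.subtype _) (b.sum_equivFun (secantPoint d z))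
    rw [map_sum] at h
    simpa [g, mul_comm] using h
  have hind : AlgebraicIndependent ℂ fun k =>
      Ideal.Quotient.mkₐ ℂ (RingHom.ker (secantHom b m)) (g k) := by
    refine AlgebraicIndependent.of_comp (Ideal.kerLiftAlg (secantHom b m)) ?_
    convert hF using 1
    ext1 k
    exact hg k
  simpa [hz] using hind.lift_cardinalMk_le_trdeg

theorem trdeg_le_mul_card_chartIndex (hn : ∀ i, 1 ≤ n i) (hd : ∀ i, 1 ≤ d i) (i₀ : Fin t) :
    Algebra.trdeg ℂ (MvPolynomial B ℂ ⧸ RingHom.ker (secantHom b m)) ≤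
      (m * Fintype.card (ChartIndex n i₀) : ℕ) := by
  classical
  let χ : MvPolynomial (Fin m × ((i : Fin t) × Fin (n i))) ℂ →ₐ[ℂ]
      MvPolynomial (Fin m × ChartIndex n i₀) ℂ :=
    aeval fun p => if h : ¬ (p.2.1 ≠ i₀ ∧ p.2.2.val = 0) then X (p.1, ⟨p.2, h⟩) else 1
  have hχ : ∀ p, χ (secantHom b m p) = 0 → secantHom b m p = 0 := by
    intro p hp
    refine Generic.eq_zero _ ((Generic.finite_forall (ι := Fin m × Fin t)
      (p := fun e z => z (e.1, ⟨e.2, ⟨0, hn e.2⟩⟩) ≠ 0) fun e =>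
        ⟨X _, X_ne_zero _, fun z hz => by simpa using hz⟩).mono fun z hz => ?_)
    choose c hc hc' using fun e => exists_chart_scaling hd i₀
      (fun i => z (e, ⟨i, ⟨0, hn i⟩⟩)) fun i => hz (e, i)
    let z' : Fin m × ((i : Fin t) × Fin (n i)) → ℂ := fun p => c p.1 p.2.1 * z p
    have hz' : secantPoint d z' = secantPoint d z := by
      rw [secantPoint, secantPoint]
      refine Finset.sum_congr rfl fun e _ => Subtype.ext ?_
      exact mono_scale_eq (c e) (hc e) fun s => z (e, s)
    rw [eval_secantHom, ← hz', ← eval_secantHom]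
    have hev : ∀ f, eval z' f = eval (fun p => z' (p.1, p.2.1)) (χ f) := by
      intro f
      have : aeval z' = (aeval fun p : Fin m × ChartIndex n i₀ => z' (p.1, p.2.1)).comp χ := by
        ext ⟨e, i, j⟩
        simp only [χ, AlgHom.comp_apply, aeval_X]
        split_ifs with h
        · obtain rfl : j = ⟨0, hn i⟩ := Fin.ext h.2
          simpa [z'] using hc' e i h.1
        · simp
      exact DFunLike.congr_fun this f
    rw [hev, hp, map_zero]
  have hinj : Function.Injective (χ.comp (Ideal.kerLiftAlg (secantHom b m))) := by
    rw [injective_iff_map_eq_zero]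
    intro a ha
    obtain ⟨p, rfl⟩ := Ideal.Quotient.mk_surjective a
    exact Ideal.Quotient.eq_zero_iff_mem.mpr (hχ p ha)
  refine (trdeg_le_of_injective _ hinj).trans ?_
  rw [MvPolynomial.trdeg_of_isDomain]
  simp

theorem tangentRank_le_mul (hn : ∀ i, 1 ≤ n i) (hd : ∀ i, 1 ≤ d i) (i₀ : Fin t) :
    tangentRank n d m ≤ m * ((∑ i, n i) - t + 1) := by
  rw [← card_chartIndex hn i₀]
  have b := Module.finBasis ℂ (multiHomogeneousSubmodule t n d)
  exact_mod_cast (tangentRank_le_trdeg b hd).trans (trdeg_le_mul_card_chartIndex b hn hd i₀)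

theorem zDimV_secantV_segreVeronese_of_tangentRank (hn : ∀ i, 1 ≤ n i) (hd : ∀ i, 1 ≤ d i)
    (i₀ : Fin t) (h : tangentRank n d m = m * ((∑ i, n i) - t + 1)) :
    zDimV (secantV m (SegreVeronese t n d)) = (m * ((∑ i, n i) - t + 1) : ℕ) := by
  have b := Module.finBasis ℂ (multiHomogeneousSubmodule t n d)
  refine zDimV_secantV_segreVeronese b (le_antisymm ?_ (h ▸ tangentRank_le_trdeg b hd))
  rw [← card_chartIndex hn i₀]
  exact trdeg_le_mul_card_chartIndex b hn hd i₀

theorem secantV_segreVeronese_eq_univ (hd : ∀ i, 1 ≤ d i)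
    (h : tangentRank n d m = Module.finrank ℂ (multiHomogeneousSubmodule t n d)) :
    secantV m (SegreVeronese t n d) = Set.univ := by
  classical
  have b := Module.finBasis ℂ (multiHomogeneousSubmodule t n d)
  obtain ⟨z, hz⟩ := exists_finrank_tangentSum_eq (n := n) hd m
  have htop : tangentSum d Finset.univ z = multiHomogeneousSubmodule t n d :=
    Submodule.eq_of_le_of_finrank_eq (tangentSum_le hd _ z) (hz.trans h)
  have hind := algebraicIndependent_coeffMap_genericSum hd (extCoord b) z fun c hc => by
    ext β
    have := hc (b β) (htop.ge (b β).2)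
    simpa [extCoord_apply, Finsupp.single_apply] using this
  refine Set.eq_univ_of_forall fun x => (mem_secantV_segreVeronese_iff b x).mpr fun p hp => ?_
  rw [hind ((RingHom.mem_ker.mp hp).trans (map_zero _).symm), map_zero]

end Secant

theorem stmt_13 (t : ℕ) (ht : 1 ≤ t) (n d : Fin t → ℕ)
    (hn : ∀ i, 1 ≤ n i) (hd : ∀ i, 1 ≤ d i)
    (N : ℕ) (hN : N = (∑ i, n i) - t + 1)
    (D : ℕ) (hD : D = ∏ i, Nat.choose (n i + d i - 1) (d i)) :
    zDimV (SegreVeronese t n d) = (N : WithBot ℕ∞) ∧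
    (∀ m : ℕ, 1 ≤ m → N * (m + N) ≤ D →
      zDimV (secantV m (SegreVeronese t n d)) = ((m * N : ℕ) : WithBot ℕ∞)) ∧
    (∀ m : ℕ, 1 ≤ m → D + N ^ 2 ≤ m * N →
      secantV m (SegreVeronese t n d) = Set.univ) := by
  let i₀ : Fin t := ⟨0, ht⟩
  rw [← finrank_multiHomogeneousSubmodule (n := n)] at hD
  subst hN hD
  have h1 : tangentRank n d 1 = (∑ i, n i) - t + 1 :=
    le_antisymm (by simpa using tangentRank_le_mul (m := 1) hn hd i₀)
      (le_tangentRank_one hn hd i₀)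
  have hs : ∀ k, tangentRank n d (k + 2) + tangentRank n d k = 2 * tangentRank n d (k + 1) →
      tangentRank n d (k + 1) < tangentRank n d k + ((∑ i, n i) - t + 1) →
      tangentRank n d k = Module.finrank ℂ (multiHomogeneousSubmodule t n d) :=
    fun k h hlt => tangentRank_eq_finrank_of_concave_eq hd h (h1 ▸ hlt)
  refine ⟨?_, fun m _ hm => ?_, fun m _ hm => ?_⟩
  · have := zDimV_secantV_segreVeronese_of_tangentRank (m := 1) hn hd i₀ (by rw [h1, one_mul])
    rwa [secantV_one_segreVeronese, one_mul] at this
  · exact zDimV_secantV_segreVeronese_of_tangentRank hn hd i₀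
      (concave_eq_linear (tangentRank_zero hd) h1 (tangentRank_mono hd) (tangentRank_le hd)
        (tangentRank_concave hd) hs (Nat.le_add_left 1 _) hm)
  · exact secantV_segreVeronese_eq_univ hd
      (concave_eq_top (tangentRank_zero hd) h1 (tangentRank_mono hd) (tangentRank_le hd)
        (tangentRank_concave hd) hs (Nat.le_add_left 1 _) hm)
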